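/- Suppose the real numbers r_1, …, r_n are chosen so that the hyperplane arrangement H is simple. Then the coefficient δ_d of the Ehrhart δ-polynomial of the Lawrence polytope P_B equals Σ_{F ∈ M_B} #(BOX(F) ∩ ℤ^d) · R^bd_F. -/

import Mathlib

open scoped BigOperators Pointwise
open Polynomial

noncomputable section

namespace LawrencePaper

attribute [local instance] Classical.propDecidable

/-- The real vector associated to an integer vector. -/
def toR (d : ℕ) (v : Fin d → ℤ) : Fin d → ℝ := fun j => (v j : ℝ)

/-- The `i`-th standard basis vector of `ℝ^n`. -/
def e (n : ℕ) (i : Fin n) : Fin n → ℝ := Pi.single i 1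

/-- The Lawrence polytope of the configuration `b`: the convex hull of the points
`(b i, e i)` and `(0, e i)`. -/
def lawrencePolytope (d n : ℕ) (b : Fin n → Fin d → ℤ) : Set ((Fin d → ℝ) × (Fin n → ℝ)) :=
  convexHull ℝ
    ((Set.range fun i => (toR d (b i), e n i)) ∪
      (Set.range fun i => ((0 : Fin d → ℝ), e n i)))

/-- The number of lattice points in the `m`-th dilate of `P`. -/
def latticeCount (d n : ℕ) (P : Set ((Fin d → ℝ) × (Fin n → ℝ))) (m : ℕ) : ℕ :=
  Nat.card {z : (Fin d → ℤ) × (Fin n → ℤ) |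
    (toR d z.1, fun j => (z.2 j : ℝ)) ∈ (m : ℝ) • P}

/-- `δ` is the Ehrhart δ-polynomial of the `(d+n-1)`-dimensional polytope `P ⊆ ℝ^{d+n}`:
it has degree at most `n+d-1` and satisfies
`(1-t)^{n+d} * Σ_{m ≥ 0} f_P(m) t^m = δ(t)` as formal power series. -/
def IsDeltaPoly (d n : ℕ) (P : Set ((Fin d → ℝ) × (Fin n → ℝ))) (δ : Polynomial ℤ) : Prop :=
  δ.natDegree ≤ n + d - 1 ∧
    (1 - PowerSeries.X) ^ (n + d) *
      PowerSeries.mk (fun m => (latticeCount d n P m : ℤ)) = (δ : PowerSeries ℤ)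

/-- Membership in the matroid `M_B`: the index set `F` corresponds to a linearly
independent subset of the configuration. -/
def memMatroid (d n : ℕ) (b : Fin n → Fin d → ℤ) (F : Finset (Fin n)) : Prop :=
  LinearIndependent ℝ (fun i : F => toR d (b i.1))

/-- The linear span of the vectors indexed by `F`. -/
def spanF (d n : ℕ) (b : Fin n → Fin d → ℤ) (F : Finset (Fin n)) : Submodule ℝ (Fin d → ℝ) :=
  Submodule.span ℝ ((fun i => toR d (b i)) '' F)

/-- The dimension of an element `F` of the matroid: the dimension of its span. -/
def dimF (d n : ℕ) (b : Fin n → Fin d → ℤ) (F : Finset (Fin n)) : ℕ :=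
  Module.finrank ℝ (spanF d n b F)

/-- `BOX(F) = { Σ_{i ∈ F} α_i b_i  :  0 < α_i < 1 }`; `BOX(∅) = {0}`. -/
def box (d n : ℕ) (b : Fin n → Fin d → ℤ) (F : Finset (Fin n)) : Set (Fin d → ℝ) :=
  {x | ∃ α : Fin n → ℝ, (∀ i ∈ F, 0 < α i ∧ α i < 1) ∧ x = ∑ i ∈ F, α i • toR d (b i)}

/-- The number of lattice points in `BOX(F)`. -/
def boxCount (d n : ℕ) (b : Fin n → Fin d → ℤ) (F : Finset (Fin n)) : ℕ :=
  Nat.card {z : Fin d → ℤ | toR d z ∈ box d n b F}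

/-- Membership in the restricted matroid `M_F`: the index set `G` corresponds to a linearly
independent subset of the induced configuration `B_F` in `ℝ^d / Span F`. -/
def memMatroidRes (d n : ℕ) (b : Fin n → Fin d → ℤ) (F G : Finset (Fin n)) : Prop :=
  (∀ i ∈ G, toR d (b i) ∉ spanF d n b F) ∧
    LinearIndependent ℝ (fun i : G => (spanF d n b F).mkQ (toR d (b i.1)))

/-- The dimension of an element `G` of the restricted matroid `M_F`: the dimension of the
span of the corresponding vectors in `ℝ^d / Span F`. -/
def dimRes (d n : ℕ) (b : Fin n → Fin d → ℤ) (F G : Finset (Fin n)) : ℕ :=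
  Module.finrank ℝ (Submodule.span ℝ ((fun i => (spanF d n b F).mkQ (toR d (b i))) '' G))

/-- `f_i`: the number of elements of the restricted matroid `M_F` of dimension `i`. -/
def fRes (d n : ℕ) (b : Fin n → Fin d → ℤ) (F : Finset (Fin n)) (i : ℕ) : ℕ :=
  Nat.card {G : Finset (Fin n) | memMatroidRes d n b F G ∧ dimRes d n b F G = i}

/-- The `h`-polynomial `h_F(t) = Σ_{i=0}^{codim F} f_i t^i (1-t)^{codim F - i}` of `M_F`. -/
def hPoly (d n : ℕ) (b : Fin n → Fin d → ℤ) (F : Finset (Fin n)) : Polynomial ℤ :=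
  ∑ i ∈ Finset.range (d - dimF d n b F + 1),
    C (fRes d n b F i : ℤ) * X ^ i * (1 - X) ^ (d - dimF d n b F - i)

/-- The hyperplane `H_i = {u : ⟨u, b_i⟩ = r_i}`. -/
def hyperplane (d n : ℕ) (b : Fin n → Fin d → ℤ) (r : Fin n → ℝ) (i : Fin n) :
    Set (Fin d → ℝ) :=
  {u | ∑ j, u j * (b i j : ℝ) = r i}

/-- The arrangement `H` is simple: the intersection of any `l` of the hyperplanes is
either empty or has codimension `l`. -/
def Simple (d n : ℕ) (b : Fin n → Fin d → ℤ) (r : Fin n → ℝ) : Prop :=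
  ∀ s : Finset (Fin n), (⋂ i ∈ s, hyperplane d n b r i) = ∅ ∨
    ∀ x ∈ ⋂ i ∈ s, hyperplane d n b r i,
      Module.finrank ℝ
        (Submodule.span ℝ ((fun u => u - x) '' ⋂ i ∈ s, hyperplane d n b r i)) + s.card = d

/-- The affine subspace `A_F = ⋂_{i ∈ F} H_i`. -/
def flat (d n : ℕ) (b : Fin n → Fin d → ℤ) (r : Fin n → ℝ) (F : Finset (Fin n)) :
    Set (Fin d → ℝ) :=
  ⋂ i ∈ F, hyperplane d n b r i

/-- The cell of the restricted arrangement `H^F` containing the point `u ∈ A_F`: all points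
of `A_F` satisfying the same relations `<`, `=`, `>` as `u` with respect to each hyperplane
of `H^F`. -/
def cellOf (d n : ℕ) (b : Fin n → Fin d → ℤ) (r : Fin n → ℝ) (F : Finset (Fin n))
    (u : Fin d → ℝ) : Set (Fin d → ℝ) :=
  {v ∈ flat d n b r F | ∀ i : Fin n, toR d (b i) ∉ spanF d n b F →
    (((∑ j, v j * (b i j : ℝ)) < r i ↔ (∑ j, u j * (b i j : ℝ)) < r i) ∧
      ((∑ j, v j * (b i j : ℝ)) = r i ↔ (∑ j, u j * (b i j : ℝ)) = r i))}

/-- `f^bd_k`: the number of bounded cells of the restricted arrangement `H^F` of dimension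
`k` (the dimension of a cell being the dimension of its affine span). -/
def fBd (d n : ℕ) (b : Fin n → Fin d → ℤ) (r : Fin n → ℝ) (F : Finset (Fin n)) (k : ℕ) : ℕ :=
  Nat.card {Cs : Set (Fin d → ℝ) | (∃ u ∈ flat d n b r F, Cs = cellOf d n b r F u) ∧
    Bornology.IsBounded Cs ∧ Module.finrank ℝ (vectorSpan ℝ Cs) = k}

/-- `h^bd_F(t) = Σ_{i=0}^{codim F} f^bd_i (t-1)^i`. -/
def hBdPoly (d n : ℕ) (b : Fin n → Fin d → ℤ) (r : Fin n → ℝ) (F : Finset (Fin n)) :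
    Polynomial ℤ :=
  ∑ i ∈ Finset.range (d - dimF d n b F + 1), C (fBd d n b r F i : ℤ) * (X - 1) ^ i

/-- The complement within `A_F` of the union of the hyperplanes of `H^F`. -/
def arrComplement (d n : ℕ) (b : Fin n → Fin d → ℤ) (r : Fin n → ℝ) (F : Finset (Fin n)) :
    Set (Fin d → ℝ) :=
  flat d n b r F \ ⋃ i ∈ {i : Fin n | toR d (b i) ∉ spanF d n b F}, hyperplane d n b r i

/-- `R^bd_F`: the number of bounded regions (connected components of the complement within
`A_F` of the union of the hyperplanes) of the restricted arrangement `H^F`. -/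
def boundedRegionCount (d n : ℕ) (b : Fin n → Fin d → ℤ) (r : Fin n → ℝ)
    (F : Finset (Fin n)) : ℕ :=
  Nat.card {R : Set (Fin d → ℝ) | (∃ x ∈ arrComplement d n b r F,
    R = connectedComponentIn (arrComplement d n b r F) x) ∧ Bornology.IsBounded R}

/-- `F` is a maximal linearly independent subset of the configuration. -/
def IsMaximalIndep (d n : ℕ) (b : Fin n → Fin d → ℤ) (F : Finset (Fin n)) : Prop :=
  memMatroid d n b F ∧ ∀ G : Finset (Fin n), memMatroid d n b G → F ⊆ G → F = G

/-- The matroid `M_B` is coloop free: no element of the configuration lies in every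
maximal linearly independent subset. -/
def ColoopFree (d n : ℕ) (b : Fin n → Fin d → ℤ) : Prop :=
  ∀ i : Fin n, ∃ F : Finset (Fin n), IsMaximalIndep d n b F ∧ i ∉ F

/-- `f_i`: the number of elements of the matroid `M_B` of dimension `i`. -/
def fMat (d n : ℕ) (b : Fin n → Fin d → ℤ) (i : ℕ) : ℕ :=
  Nat.card {F : Finset (Fin n) | memMatroid d n b F ∧ dimF d n b F = i}

section SignedRegions

variable {ι V : Type*} [AddCommGroup V] [Module ℝ V]

/-- The points of the flat indexed by `G` lying on the side of each hyperplane in `s`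
prescribed by the sign pattern `σ`. -/
def signRegion (f : ι → Module.Dual ℝ V) (r : ι → ℝ) (G s σ : Finset ι) : Set V :=
  {u | (∀ i ∈ G, f i u = r i) ∧ ∀ i ∈ s, (i ∈ σ → r i < f i u) ∧ (i ∉ σ → f i u < r i)}

/-- The recession cone of a nonempty `signRegion`. -/
def recCone (f : ι → Module.Dual ℝ V) (G s σ : Finset ι) : Set V :=
  {v | (∀ i ∈ G, f i v = 0) ∧ ∀ i ∈ s, (i ∈ σ → 0 ≤ f i v) ∧ (i ∉ σ → f i v ≤ 0)}

/-- A sign pattern is bounded if its region is nonempty with trivial recession cone. -/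
def IsBddSign (f : ι → Module.Dual ℝ V) (r : ι → ℝ) (G s σ : Finset ι) : Prop :=
  (signRegion f r G s σ).Nonempty ∧ ∀ v ∈ recCone f G s σ, v = 0

/-- The sign patterns of the bounded regions. -/
def bddSigns (f : ι → Module.Dual ℝ V) (r : ι → ℝ) (G s : Finset ι) : Finset (Finset ι) :=
  s.powerset.filter (IsBddSign f r G s)

lemma card_bddSigns (f : ι → Module.Dual ℝ V) (r : ι → ℝ) (G s : Finset ι) :
    (bddSigns f r G s).card = ∑ σ ∈ s.powerset, if IsBddSign f r G s σ then 1 else 0 := by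
  rw [bddSigns, Finset.card_filter]

lemma signRegion_insert_pos [DecidableEq ι] (f : ι → Module.Dual ℝ V) (r : ι → ℝ)
    {G s σ : Finset ι} {i : ι} (hi : i ∉ s) :
    signRegion f r G (insert i s) (insert i σ) = signRegion f r G s σ ∩ {u | r i < f i u} := by
  ext u
  have hne : ∀ j ∈ s, j ≠ i := fun j hj h => hi (h ▸ hj)
  simp only [signRegion, Set.mem_ofPred_eq, Set.mem_inter_iff, Finset.forall_mem_insert]
  simp only [Finset.mem_insert, true_or, forall_true_left, not_true_eq_false, false_imp_iff,
    and_true]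
  constructor
  · rintro ⟨h1, h2, h3⟩
    exact ⟨⟨h1, fun j hj => by simpa [hne j hj] using h3 j hj⟩, h2⟩
  · rintro ⟨⟨h1, h3⟩, h2⟩
    exact ⟨h1, h2, fun j hj => by simpa [hne j hj] using h3 j hj⟩

lemma signRegion_insert_neg [DecidableEq ι] (f : ι → Module.Dual ℝ V) (r : ι → ℝ)
    {G s σ : Finset ι} {i : ι} (hi : i ∉ σ) :
    signRegion f r G (insert i s) σ = signRegion f r G s σ ∩ {u | f i u < r i} := by
  ext u
  simp only [signRegion, Set.mem_ofPred_eq, Set.mem_inter_iff, Finset.forall_mem_insert, hi,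
    false_imp_iff, not_false_eq_true, true_imp_iff, true_and]
  tauto

lemma signRegion_insert_flat [DecidableEq ι] (f : ι → Module.Dual ℝ V) (r : ι → ℝ)
    {G s σ : Finset ι} {i : ι} :
    signRegion f r (insert i G) s σ = signRegion f r G s σ ∩ {u | f i u = r i} := by
  ext u
  simp only [signRegion, Set.mem_ofPred_eq, Set.mem_inter_iff, Finset.forall_mem_insert]
  tauto

lemma recCone_insert_pos [DecidableEq ι] (f : ι → Module.Dual ℝ V) {G s σ : Finset ι} {i : ι}
    (hi : i ∉ s) :
    recCone f G (insert i s) (insert i σ) = recCone f G s σ ∩ {u | 0 ≤ f i u} := by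
  ext u
  have hne : ∀ j ∈ s, j ≠ i := fun j hj h => hi (h ▸ hj)
  simp only [recCone, Set.mem_ofPred_eq, Set.mem_inter_iff, Finset.forall_mem_insert]
  simp only [Finset.mem_insert, true_or, forall_true_left, not_true_eq_false, false_imp_iff,
    and_true]
  constructor
  · rintro ⟨h1, h2, h3⟩
    exact ⟨⟨h1, fun j hj => by simpa [hne j hj] using h3 j hj⟩, h2⟩
  · rintro ⟨⟨h1, h3⟩, h2⟩
    exact ⟨h1, h2, fun j hj => by simpa [hne j hj] using h3 j hj⟩

lemma recCone_insert_neg [DecidableEq ι] (f : ι → Module.Dual ℝ V) {G s σ : Finset ι} {i : ι}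
    (hi : i ∉ σ) :
    recCone f G (insert i s) σ = recCone f G s σ ∩ {u | f i u ≤ 0} := by
  ext u
  simp only [recCone, Set.mem_ofPred_eq, Set.mem_inter_iff, Finset.forall_mem_insert, hi,
    false_imp_iff, not_false_eq_true, true_imp_iff, true_and]
  tauto

lemma recCone_insert_flat [DecidableEq ι] (f : ι → Module.Dual ℝ V) {G s σ : Finset ι} {i : ι} :
    recCone f (insert i G) s σ = recCone f G s σ ∩ {u | f i u = 0} := by
  ext u
  simp only [recCone, Set.mem_ofPred_eq, Set.mem_inter_iff, Finset.forall_mem_insert]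
  tauto

lemma convex_signRegion (f : ι → Module.Dual ℝ V) (r : ι → ℝ) (G s σ : Finset ι) :
    Convex ℝ (signRegion f r G s σ) := by
  have : signRegion f r G s σ = (⋂ i ∈ G, {u | f i u = r i}) ∩
      ⋂ i ∈ s, ((⋂ _ : i ∈ σ, {u | r i < f i u}) ∩ ⋂ _ : i ∉ σ, {u | f i u < r i}) := by
    ext u; simp [signRegion]
  rw [this]
  refine Convex.inter (convex_iInter₂ fun i _ => convex_hyperplane (f i).isLinear _)
    (convex_iInter₂ fun i _ => Convex.inter
      (convex_iInter fun _ => convex_halfSpace_gt (f i).isLinear _)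
      (convex_iInter fun _ => convex_halfSpace_lt (f i).isLinear _))

lemma add_smul_mem_signRegion {f : ι → Module.Dual ℝ V} {r : ι → ℝ} {G s σ : Finset ι}
    {u v : V} (hu : u ∈ signRegion f r G s σ) (hv : v ∈ recCone f G s σ) {t : ℝ} (ht : 0 ≤ t) :
    u + t • v ∈ signRegion f r G s σ := by
  refine ⟨fun i hi => ?_, fun i hi => ⟨fun h => ?_, fun h => ?_⟩⟩
  · simp [hu.1 i hi, hv.1 i hi]
  · have h1 := (hu.2 i hi).1 h
    have h2 := mul_nonneg ht ((hv.2 i hi).1 h)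
    simp only [map_add, map_smul, smul_eq_mul]; linarith
  · have h1 := (hu.2 i hi).2 h
    have h2 := mul_nonneg ht (neg_nonneg.2 ((hv.2 i hi).2 h))
    simp only [map_add, map_smul, smul_eq_mul]; linarith

lemma add_mem_recCone {f : ι → Module.Dual ℝ V} {G s σ : Finset ι} {u v : V}
    (hu : u ∈ recCone f G s σ) (hv : v ∈ recCone f G s σ) : u + v ∈ recCone f G s σ := by
  refine ⟨fun i hi => ?_, fun i hi => ⟨fun h => ?_, fun h => ?_⟩⟩
  · simp [hu.1 i hi, hv.1 i hi]
  · simpa using add_nonneg ((hu.2 i hi).1 h) ((hv.2 i hi).1 h)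
  · simpa using add_nonpos ((hu.2 i hi).2 h) ((hv.2 i hi).2 h)

lemma smul_mem_recCone {f : ι → Module.Dual ℝ V} {G s σ : Finset ι} {v : V}
    (hv : v ∈ recCone f G s σ) {t : ℝ} (ht : 0 ≤ t) : t • v ∈ recCone f G s σ := by
  refine ⟨fun i hi => ?_, fun i hi => ⟨fun h => ?_, fun h => ?_⟩⟩
  · simp [hv.1 i hi]
  · simpa using mul_nonneg ht ((hv.2 i hi).1 h)
  · simpa using mul_nonpos_of_nonneg_of_nonpos ht ((hv.2 i hi).2 h)

/-- Moving by a small amount in both directions along the flat stays in the region. -/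
lemma exists_smul_mem_signRegion {f : ι → Module.Dual ℝ V} {r : ι → ℝ} {G s σ : Finset ι}
    {u v : V} (hu : u ∈ signRegion f r G s σ) (hv : ∀ i ∈ G, f i v = 0) :
    ∃ t : ℝ, 0 < t ∧ u + t • v ∈ signRegion f r G s σ ∧ u - t • v ∈ signRegion f r G s σ := by
  have key : ∀ w : V, (∀ i ∈ G, f i w = 0) →
      ∀ᶠ t : ℝ in nhdsWithin 0 (Set.Ioi 0), u + t • w ∈ signRegion f r G s σ := by
    intro w hw
    have hc : ∀ i, Filter.Tendsto (fun t : ℝ => f i u + t * f i w)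
        (nhdsWithin 0 (Set.Ioi 0)) (nhds (f i u)) := fun i => by
      have : Continuous (fun t : ℝ => f i u + t * f i w) := by fun_prop
      simpa using (this.tendsto 0).mono_left nhdsWithin_le_nhds
    have h2 : ∀ᶠ t : ℝ in nhdsWithin 0 (Set.Ioi 0), ∀ i ∈ s,
        (i ∈ σ → r i < f i u + t * f i w) ∧ (i ∉ σ → f i u + t * f i w < r i) := by
      rw [Filter.eventually_all_finset]
      intro i hi
      by_cases h : i ∈ σ
      · filter_upwards [(hc i).eventually_const_lt ((hu.2 i hi).1 h)] with t ht
        exact ⟨fun _ => ht, fun h' => absurd h h'⟩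
      · filter_upwards [(hc i).eventually_lt_const ((hu.2 i hi).2 h)] with t ht
        exact ⟨fun h' => absurd h' h, fun _ => ht⟩
    filter_upwards [h2] with t ht
    exact ⟨fun i hi => by simp [hu.1 i hi, hw i hi], fun i hi => by simpa using ht i hi⟩
  obtain ⟨t, ⟨h1, h2⟩, h3⟩ := (((key v hv).and (key (-v) (by simpa using hv))).and
    self_mem_nhdsWithin).exists
  exact ⟨t, h3, h1, by simpa [sub_eq_add_neg] using h2⟩

/-- The two sides of a hyperplane that meets the region are nonempty. -/
lemma signRegion_inter_sides {f : ι → Module.Dual ℝ V} {r : ι → ℝ} {G s σ : Finset ι} {i : ι}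
    (hdir : (∃ u, (∀ j ∈ G, f j u = r j) ∧ f i u = r i) →
      ∃ v, (∀ j ∈ G, f j v = 0) ∧ f i v ≠ 0)
    (h : (signRegion f r G s σ ∩ {u | f i u = r i}).Nonempty) :
    (signRegion f r G s σ ∩ {u | f i u < r i}).Nonempty ∧
      (signRegion f r G s σ ∩ {u | r i < f i u}).Nonempty := by
  obtain ⟨u, hu, hui⟩ := h
  obtain ⟨v, hv, hvi⟩ := hdir ⟨u, hu.1, hui⟩
  obtain ⟨t, ht, hp, hm⟩ := exists_smul_mem_signRegion hu hv
  have h1 : f i (u + t • v) = r i + t * f i v := by simpa using hui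
  have h2 : f i (u - t • v) = r i - t * f i v := by simpa using hui
  rcases lt_or_gt_of_ne hvi with h | h
  · have := mul_neg_of_pos_of_neg ht h
    exact ⟨⟨_, hp, show f i _ < r i by linarith⟩, ⟨_, hm, show r i < f i _ by linarith⟩⟩
  · have := mul_pos ht h
    exact ⟨⟨_, hm, show f i _ < r i by linarith⟩, ⟨_, hp, show r i < f i _ by linarith⟩⟩

lemma signRegion_inter_hyperplane {f : ι → Module.Dual ℝ V} {r : ι → ℝ} {G s σ : Finset ι} {i : ι}
    (ha : (signRegion f r G s σ ∩ {u | f i u < r i}).Nonempty)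
    (hb : (signRegion f r G s σ ∩ {u | r i < f i u}).Nonempty) :
    (signRegion f r G s σ ∩ {u | f i u = r i}).Nonempty := by
  obtain ⟨x, hx, hxi⟩ := ha
  obtain ⟨y, hy, hyi⟩ := hb
  simp only [Set.mem_ofPred_eq] at hxi hyi
  have hden : 0 < f i y - f i x := by linarith
  refine ⟨((f i y - r i) / (f i y - f i x)) • x + ((r i - f i x) / (f i y - f i x)) • y,
    convex_signRegion f r G s σ hx hy (div_nonneg (by linarith) hden.le)
      (div_nonneg (by linarith) hden.le) (by field_simp; ring), ?_⟩
  simp only [Set.mem_ofPred_eq, map_add, map_smul, smul_eq_mul]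
  field_simp
  ring

/-- If the hyperplane cuts the recession cone trivially, the cone lies on one side. -/
lemma recCone_one_side {f : ι → Module.Dual ℝ V} {G s σ : Finset ι} {i : ι}
    (hcol : ∀ v, (∀ j ∈ G, f j v = 0) → (∀ j ∈ s, f j v = 0) → f i v = 0)
    (h0 : ∀ v ∈ recCone f G s σ ∩ {u | f i u = 0}, v = 0) :
    (∀ v ∈ recCone f G s σ ∩ {u | f i u ≤ 0}, v = 0) ∨
      ∀ v ∈ recCone f G s σ ∩ {u | 0 ≤ f i u}, v = 0 := by
  by_contra! h
  obtain ⟨⟨v, ⟨hv, hvi⟩, hv0⟩, ⟨w, ⟨hw, hwi⟩, hw0⟩⟩ := h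
  have hvi' : f i v < 0 := lt_of_le_of_ne hvi fun h => hv0 (h0 v ⟨hv, h⟩)
  have hwi' : 0 < f i w := lt_of_le_of_ne hwi fun h => hw0 (h0 w ⟨hw, h.symm⟩)
  have hz := h0 (f i w • v + (-f i v) • w) ⟨add_mem_recCone (smul_mem_recCone hv hwi'.le)
    (smul_mem_recCone hw (by linarith)), by
      simp only [Set.mem_ofPred_eq, map_add, map_smul, smul_eq_mul]; ring⟩
  have hj : ∀ j, f i w * f j v = f i v * f j w := fun j => by
    have := congrArg (f j) hz
    simp only [map_add, map_smul, smul_eq_mul, map_zero] at this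
    linarith
  refine hvi'.ne (hcol v hv.1 fun j hjs => ?_)
  by_cases h : j ∈ σ
  · nlinarith [(hv.2 j hjs).1 h, (hw.2 j hjs).1 h, hj j]
  · nlinarith [(hv.2 j hjs).2 h, (hw.2 j hjs).2 h, hj j]

/-- Cutting a region by a hyperplane whose normal is determined by the other ones. -/
lemma isBddSign_insert [DecidableEq ι] {f : ι → Module.Dual ℝ V} {r : ι → ℝ}
    {G s σ : Finset ι} {i : ι} (hi : i ∉ s) (hσ : σ ⊆ s)
    (hcol : ∀ v, (∀ j ∈ G, f j v = 0) → (∀ j ∈ s, f j v = 0) → f i v = 0)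
    (hdir : (∃ u, (∀ j ∈ G, f j u = r j) ∧ f i u = r i) →
      ∃ v, (∀ j ∈ G, f j v = 0) ∧ f i v ≠ 0) :
    ((if IsBddSign f r G (insert i s) σ then 1 else 0) +
      if IsBddSign f r G (insert i s) (insert i σ) then 1 else 0 : ℕ) =
    (if IsBddSign f r G s σ then 1 else 0) + if IsBddSign f r (insert i G) s σ then 1 else 0 := by
  have hiσ : i ∉ σ := fun h => hi (hσ h)
  have e (G s σ : Finset ι) : IsBddSign f r G s σ ↔
      (signRegion f r G s σ).Nonempty ∧ ∀ v ∈ recCone f G s σ, v = 0 := Iff.rfl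
  have e1 := e G (insert i s) σ
  have e2 := e G (insert i s) (insert i σ)
  have e3 := e (insert i G) s σ
  have e4 := e G s σ
  rw [signRegion_insert_neg f r hiσ, recCone_insert_neg f hiσ] at e1
  rw [signRegion_insert_pos f r hi, recCone_insert_pos f hi] at e2
  rw [signRegion_insert_flat, recCone_insert_flat] at e3
  have hZ := signRegion_inter_sides (f := f) (r := r) (s := s) (σ := σ) hdir
  have hAB := signRegion_inter_hyperplane (f := f) (r := r) (G := G) (s := s) (σ := σ) (i := i)
  have hz := recCone_one_side (f := f) (σ := σ) hcol
  have hN : (signRegion f r G s σ).Nonempty → (signRegion f r G s σ ∩ {u | f i u < r i}).Nonempty ∨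
      (signRegion f r G s σ ∩ {u | r i < f i u}).Nonempty := by
    rintro ⟨u, hu⟩
    rcases lt_trichotomy (f i u) (r i) with h | h | h
    · exact Or.inl ⟨u, hu, h⟩
    · exact Or.inl (hZ ⟨u, hu, h⟩).1
    · exact Or.inr ⟨u, hu, h⟩
  have hsub : ∀ S : Set V, (signRegion f r G s σ ∩ S).Nonempty → (signRegion f r G s σ).Nonempty :=
    fun S h => h.mono Set.inter_subset_left
  have hk : ∀ S : Set V, (∀ v ∈ recCone f G s σ, v = 0) → ∀ v ∈ recCone f G s σ ∩ S, v = 0 :=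
    fun S h v hv => h v hv.1
  have hab : (∀ v ∈ recCone f G s σ ∩ {u | f i u ≤ 0}, v = 0) →
      (∀ v ∈ recCone f G s σ ∩ {u | 0 ≤ f i u}, v = 0) → ∀ v ∈ recCone f G s σ, v = 0 :=
    fun ha hb v hv => (le_total (f i v) 0).elim (fun h => ha v ⟨hv, h⟩) fun h => hb v ⟨hv, h⟩
  have haz : (∀ v ∈ recCone f G s σ ∩ {u | f i u ≤ 0}, v = 0) →
      ∀ v ∈ recCone f G s σ ∩ {u | f i u = 0}, v = 0 := fun h v hv => h v ⟨hv.1, le_of_eq hv.2⟩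
  have hbz : (∀ v ∈ recCone f G s σ ∩ {u | 0 ≤ f i u}, v = 0) →
      ∀ v ∈ recCone f G s σ ∩ {u | f i u = 0}, v = 0 :=
    fun h v hv => h v ⟨hv.1, ge_of_eq hv.2⟩
  have hak : (signRegion f r G s σ).Nonempty →
      ¬ (signRegion f r G s σ ∩ {u | r i < f i u}).Nonempty →
      (∀ v ∈ recCone f G s σ ∩ {u | f i u ≤ 0}, v = 0) → ∀ v ∈ recCone f G s σ, v = 0 := by
    rintro ⟨u, hu⟩ hB ha v hv
    by_contra hv0
    have hvi : 0 < f i v := by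
      by_contra! h
      exact hv0 (ha v ⟨hv, h⟩)
    refine hB ⟨u + ((|r i - f i u| + 1) / f i v) • v,
      add_smul_mem_signRegion hu hv (by positivity), ?_⟩
    simp only [Set.mem_ofPred_eq, map_add, map_smul, smul_eq_mul, div_mul_cancel₀ _ hvi.ne']
    linarith [le_abs_self (r i - f i u)]
  have hbk : (signRegion f r G s σ).Nonempty →
      ¬ (signRegion f r G s σ ∩ {u | f i u < r i}).Nonempty →
      (∀ v ∈ recCone f G s σ ∩ {u | 0 ≤ f i u}, v = 0) → ∀ v ∈ recCone f G s σ, v = 0 := by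
    rintro ⟨u, hu⟩ hA hb v hv
    by_contra hv0
    have hvi : f i v < 0 := by
      by_contra! h
      exact hv0 (hb v ⟨hv, h⟩)
    have hvi' : 0 < -f i v := by linarith
    refine hA ⟨u + ((|r i - f i u| + 1) / (-f i v)) • v,
      add_smul_mem_signRegion hu hv (by positivity), ?_⟩
    have : (|r i - f i u| + 1) / (-f i v) * f i v = -(|r i - f i u| + 1) := by
      rw [div_neg, neg_mul, div_mul_cancel₀ _ hvi.ne]
    simp only [Set.mem_ofPred_eq, map_add, map_smul, smul_eq_mul, this]
    linarith [neg_abs_le (r i - f i u)]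
  rw [if_congr e1 rfl rfl, if_congr e2 rfl rfl, if_congr e3 rfl rfl, if_congr e4 rfl rfl]
  clear e e1 e2 e3 e4
  have hsA := hsub {u | f i u < r i}
  have hsB := hsub {u | r i < f i u}
  have hsZ := hsub {u | f i u = r i}
  have hkA := hk {u | f i u ≤ 0}
  have hkB := hk {u | 0 ≤ f i u}
  have hkZ := hk {u | f i u = 0}
  clear hsub hk hdir hcol
  generalize (signRegion f r G s σ ∩ {u | f i u < r i}).Nonempty = A at *
  generalize (signRegion f r G s σ ∩ {u | r i < f i u}).Nonempty = B at *
  generalize (signRegion f r G s σ ∩ {u | f i u = r i}).Nonempty = Z at *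
  generalize (signRegion f r G s σ).Nonempty = N at *
  generalize (∀ v ∈ recCone f G s σ ∩ {u | f i u ≤ 0}, v = 0) = a at *
  generalize (∀ v ∈ recCone f G s σ ∩ {u | 0 ≤ f i u}, v = 0) = b at *
  generalize (∀ v ∈ recCone f G s σ ∩ {u | f i u = 0}, v = 0) = z at *
  generalize (∀ v ∈ recCone f G s σ, v = 0) = k at *
  by_cases A <;> by_cases B <;> by_cases Z <;> by_cases N <;> by_cases a <;> by_cases b <;>
    by_cases z <;> by_cases k <;> simp_all

/-- Deletion and restriction for the number of bounded regions. -/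
lemma card_bddSigns_insert [DecidableEq ι] {f : ι → Module.Dual ℝ V} {r : ι → ℝ}
    {G s : Finset ι} {i : ι}
    (hi : i ∉ s)
    (hcol : ∀ v, (∀ j ∈ G, f j v = 0) → (∀ j ∈ s, f j v = 0) → f i v = 0)
    (hdir : (∃ u, (∀ j ∈ G, f j u = r j) ∧ f i u = r i) →
      ∃ v, (∀ j ∈ G, f j v = 0) ∧ f i v ≠ 0) :
    (bddSigns f r G (insert i s)).card =
      (bddSigns f r G s).card + (bddSigns f r (insert i G) s).card := by
  simp only [card_bddSigns]
  rw [Finset.sum_powerset_insert hi, ← Finset.sum_add_distrib, ← Finset.sum_add_distrib]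
  exact Finset.sum_congr rfl fun σ hσ =>
    isBddSign_insert hi (Finset.mem_powerset.1 hσ) hcol hdir

/-- The number of bounded regions of a simple arrangement, restricted to a flat. -/
theorem card_bddSigns_eq_sum [DecidableEq ι] [FiniteDimensional ℝ V] {f : ι → Module.Dual ℝ V}
    {r : ι → ℝ}
    (hsimp : ∀ F : Finset ι, (∃ u, ∀ i ∈ F, f i u = r i) → LinearIndepOn ℝ f (F : Set ι))
    (s : Finset ι) : ∀ G : Finset ι, LinearIndepOn ℝ f (G : Set ι) → Disjoint G s →
    (∀ v, (∀ j ∈ G, f j v = 0) → (∀ j ∈ s, f j v = 0) → v = 0) →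
    ((bddSigns f r G s).card : ℤ) = ∑ F ∈ s.powerset,
      if LinearIndepOn ℝ f ((G ∪ F : Finset ι) : Set ι) then
        (-1) ^ (Module.finrank ℝ V + (G ∪ F).card) else 0 := by
  induction s using Finset.induction_on with
  | empty =>
    intro G hG _ hspan
    let φ : V →ₗ[ℝ] (G → ℝ) := LinearMap.pi fun i => f i
    have hinj : Function.Injective φ := by
      rw [injective_iff_map_eq_zero]
      intro v hv
      exact hspan v (fun j hj => congrFun hv ⟨j, hj⟩) (by simp)
    have hrank : Module.finrank ℝ V = G.card := by
      apply le_antisymm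
      · simpa using LinearMap.finrank_le_finrank_of_injective hinj
      · simpa [Subspace.dual_finrank_eq] using LinearIndependent.fintype_card_le_finrank hG
    obtain ⟨u, hu⟩ := (LinearMap.injective_iff_surjective_of_finrank_eq_finrank
      (f := φ) (by simpa using hrank)).1 hinj fun i => r i
    have hb : IsBddSign f r G ∅ ∅ :=
      ⟨⟨u, fun j hj => congrFun hu ⟨j, hj⟩, by simp⟩, fun v hv => hspan v hv.1 (by simp)⟩
    have hb' : bddSigns f r G ∅ = {∅} := by
      rw [bddSigns, Finset.powerset_empty, Finset.filter_singleton, if_pos hb]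
    simp [hb', hG, hrank, ← two_mul]
  | insert i s hi ih =>
    intro G hG hdisj hspan
    rw [Finset.disjoint_insert_right] at hdisj
    rw [Finset.sum_powerset_insert hi]
    by_cases hcol : ∀ v, (∀ j ∈ G, f j v = 0) → (∀ j ∈ s, f j v = 0) → f i v = 0
    · have hspan' : ∀ v, (∀ j ∈ G, f j v = 0) → (∀ j ∈ s, f j v = 0) → v = 0 := fun v h1 h2 =>
        hspan v h1 (Finset.forall_mem_insert _ _ _ |>.2 ⟨hcol v h1 h2, h2⟩)
      have hdir : (∃ u, (∀ j ∈ G, f j u = r j) ∧ f i u = r i) →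
          ∃ v, (∀ j ∈ G, f j v = 0) ∧ f i v ≠ 0 := by
        rintro ⟨u, hu, hui⟩
        have hind := hsimp (insert i G) ⟨u, Finset.forall_mem_insert _ _ _ |>.2 ⟨hui, hu⟩⟩
        rw [Finset.coe_insert, linearIndepOn_insert (by simpa using hdisj.1)] at hind
        by_contra! hcon
        apply hind.2
        rw [Set.image_eq_range]
        refine mem_span_of_iInf_ker_le_ker fun v hv => ?_
        simp only [Submodule.mem_iInf, LinearMap.mem_ker] at hv
        exact hcon v fun j hj => hv ⟨j, hj⟩
      rw [card_bddSigns_insert hi hcol hdir, Nat.cast_add, ih G hG hdisj.2 hspan']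
      congr 1
      simp_rw [Finset.union_insert, ← Finset.insert_union]
      by_cases hind : LinearIndepOn ℝ f ((insert i G : Finset ι) : Set ι)
      · exact ih (insert i G) hind (Finset.disjoint_insert_left.2 ⟨hi, hdisj.2⟩) fun v h1 h2 =>
          hspan' v (fun j hj => h1 j (Finset.mem_insert_of_mem hj)) h2
      · have h0 : bddSigns f r (insert i G) s = ∅ := by
          refine Finset.filter_eq_empty_iff.2 fun σ _ h => ?_
          obtain ⟨u, hu⟩ := h.1
          exact hind (hsimp _ ⟨u, hu.1⟩)
        rw [h0, Finset.sum_eq_zero]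
        · simp
        · intro F _
          rw [if_neg fun h => hind (h.mono (by simp [Set.insert_subset_insert]))]
    · push Not at hcol
      obtain ⟨v, hv1, hv2, hvi⟩ := hcol
      have h0 : bddSigns f r G (insert i s) = ∅ := by
        refine Finset.filter_eq_empty_iff.2 fun σ _ h => hvi ?_
        have hmem : ∀ c : ℝ, ((i ∈ σ → 0 ≤ c * f i v) ∧ (i ∉ σ → c * f i v ≤ 0)) →
            c • v ∈ recCone f G (insert i s) σ := fun c hc =>
          ⟨fun j hj => by simp [hv1 j hj], Finset.forall_mem_insert _ _ _ |>.2
            ⟨by simpa using hc, fun j hj => by simp [hv2 j hj]⟩⟩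
        by_cases hiσ : i ∈ σ
        · have := congrArg (f i) (h.2 _ (hmem (f i v) ⟨fun _ => mul_self_nonneg _,
            fun h => absurd hiσ h⟩))
          simpa using this
        · have := congrArg (f i) (h.2 _ (hmem (-f i v) ⟨fun h => absurd h hiσ,
            fun _ => by nlinarith [mul_self_nonneg (f i v)]⟩))
          simpa using this
      rw [h0, ← Finset.sum_add_distrib, Finset.sum_eq_zero]
      · simp
      · intro F hF
        have hF' := Finset.mem_powerset.1 hF
        have hiGF : i ∉ G ∪ F := by
          simp only [Finset.mem_union, not_or]
          exact ⟨hdisj.1, fun h => hi (hF' h)⟩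
        have hspan : f i ∉ Submodule.span ℝ (f '' ((G ∪ F : Finset ι) : Set ι)) := fun h => by
          have hle : Submodule.span ℝ (f '' ((G ∪ F : Finset ι) : Set ι)) ≤
              LinearMap.ker (Module.Dual.eval ℝ V v) := by
            rw [Submodule.span_le]
            rintro _ ⟨j, hj, rfl⟩
            rcases Finset.mem_union.1 hj with hj | hj
            · exact hv1 j hj
            · exact hv2 j (hF' hj)
          exact hvi (hle h)
        rw [Finset.union_insert, Finset.coe_insert, linearIndepOn_insert (by simpa using hiGF),
          Finset.card_insert_of_notMem hiGF]
        simp only [hspan, not_false_eq_true, and_true]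
        split_ifs
        · ring
        · ring

end SignedRegions
section Topology

variable {ι V : Type*} [NormedAddCommGroup V] [NormedSpace ℝ V] [FiniteDimensional ℝ V]

lemma dual_continuous (g : Module.Dual ℝ V) : Continuous g :=
  LinearMap.continuous_of_finiteDimensional g

/-- A nonempty region is bounded exactly when its recession cone is trivial. -/
lemma isBounded_signRegion_iff {f : ι → Module.Dual ℝ V} {r : ι → ℝ} {G s σ : Finset ι}
    (hne : (signRegion f r G s σ).Nonempty) :
    Bornology.IsBounded (signRegion f r G s σ) ↔ ∀ v ∈ recCone f G s σ, v = 0 := by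
  obtain ⟨x, hx⟩ := hne
  constructor
  · intro hb v hv
    by_contra hv0
    obtain ⟨M, hM⟩ := hb.exists_norm_le
    have hpos : 0 < ‖v‖ := norm_pos_iff.2 hv0
    have hM0 : 0 ≤ M := (norm_nonneg x).trans (hM x hx)
    have ht : 0 ≤ (2 * M + 1) / ‖v‖ := by positivity
    have h1 := hM _ (add_smul_mem_signRegion hx hv ht)
    have h2 : ‖((2 * M + 1) / ‖v‖) • v‖ = 2 * M + 1 := by
      rw [norm_smul, Real.norm_of_nonneg ht, div_mul_cancel₀ _ hpos.ne']
    have h3 := norm_sub_le (x + ((2 * M + 1) / ‖v‖) • v) x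
    rw [add_sub_cancel_left, h2] at h3
    linarith [hM x hx]
  · intro h
    by_contra hb
    have hex : ∀ k : ℕ, ∃ u ∈ signRegion f r G s σ, (k : ℝ) + 1 < ‖u - x‖ := by
      intro k
      by_contra! hk
      refine hb ((Metric.isBounded_closedBall (x := x) (r := (k : ℝ) + 1)).subset fun u hu => ?_)
      rw [mem_closedBall_iff_norm]
      exact hk u hu
    choose u hu hux using hex
    have hpos : ∀ k, 0 < ‖u k - x‖ := fun k => lt_trans (by positivity) (hux k)
    have hinv : Filter.Tendsto (fun k => ‖u k - x‖⁻¹) Filter.atTop (nhds 0) := by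
      refine Filter.Tendsto.inv_tendsto_atTop ?_
      exact Filter.tendsto_atTop_mono (fun k => (hux k).le)
        (Filter.tendsto_atTop_add_const_right _ _ tendsto_natCast_atTop_atTop)
    have hsph : ∀ k, ‖u k - x‖⁻¹ • (u k - x) ∈ Metric.sphere (0 : V) 1 := fun k => by
      rw [mem_sphere_zero_iff_norm, norm_smul, norm_inv, norm_norm, inv_mul_cancel₀ (hpos k).ne']
    have : ProperSpace V := FiniteDimensional.proper ℝ V
    obtain ⟨v, hv, φ, hφ, hlim⟩ := (isCompact_sphere (0 : V) 1).tendsto_subseq hsph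
    have hf : ∀ i, Filter.Tendsto (fun k => ‖u (φ k) - x‖⁻¹ * (f i (u (φ k)) - f i x))
        Filter.atTop (nhds (f i v)) := fun i => by
      have := ((dual_continuous (f i)).tendsto v).comp hlim
      simpa [Function.comp_def] using this
    have hc : ∀ c : ℝ, Filter.Tendsto (fun k => ‖u (φ k) - x‖⁻¹ * c) Filter.atTop (nhds 0) :=
      fun c => by simpa using (hinv.comp hφ.tendsto_atTop).mul_const c
    have hv0 : v = 0 := by
      refine h v ⟨fun i hi => ?_, fun i hi => ⟨fun hiσ => ?_, fun hiσ => ?_⟩⟩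
      · refine tendsto_nhds_unique (hf i) ?_
        simp [(hu _).1 i hi, hx.1 i hi]
      · refine le_of_tendsto_of_tendsto' (hc (r i - f i x)) (hf i) fun k => ?_
        have := ((hu (φ k)).2 i hi).1 hiσ
        exact mul_le_mul_of_nonneg_left (by linarith) (inv_nonneg.2 (norm_nonneg _))
      · refine le_of_tendsto_of_tendsto' (hf i) (hc (r i - f i x)) fun k => ?_
        have := ((hu (φ k)).2 i hi).2 hiσ
        exact mul_le_mul_of_nonneg_left (by linarith) (inv_nonneg.2 (norm_nonneg _))
    simp [hv0] at hv

/-- The connected components of the complement of an arrangement are its sign regions. -/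
lemma connectedComponentIn_eq_signRegion {f : ι → Module.Dual ℝ V} {r : ι → ℝ} {G s σ : Finset ι}
    {C : Set V} (hC : C = {u | (∀ i ∈ G, f i u = r i) ∧ ∀ i ∈ s, f i u ≠ r i})
    {x : V} (hx : x ∈ signRegion f r G s σ) :
    connectedComponentIn C x = signRegion f r G s σ := by
  have hsub : signRegion f r G s σ ⊆ C := by
    rw [hC]
    intro u hu
    refine ⟨hu.1, fun i hi => ?_⟩
    by_cases h : i ∈ σ
    · exact ((hu.2 i hi).1 h).ne'
    · exact ((hu.2 i hi).2 h).ne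
  refine Set.Subset.antisymm (fun y hy => ?_)
    ((convex_signRegion f r G s σ).isPreconnected.subset_connectedComponentIn hx hsub)
  have hyC := connectedComponentIn_subset C x hy
  rw [hC] at hyC
  have hxx : x ∈ connectedComponentIn C x := mem_connectedComponentIn (hsub hx)
  have himg : ∀ i ∈ s, r i ∉ f i '' connectedComponentIn C x := by
    rintro i hi ⟨z, hz, hzi⟩
    have := connectedComponentIn_subset C x hz
    rw [hC] at this
    exact this.2 i hi hzi
  have hpre : ∀ i, IsPreconnected (f i '' connectedComponentIn C x) := fun i =>
    isPreconnected_connectedComponentIn.image _ (dual_continuous (f i)).continuousOn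
  refine ⟨hyC.1, fun i hi => ⟨fun h => ?_, fun h => ?_⟩⟩
  · by_contra! hlt
    exact himg i hi ((hpre i).Icc_subset ⟨y, hy, rfl⟩ ⟨x, hxx, rfl⟩
      ⟨hlt, ((hx.2 i hi).1 h).le⟩)
  · by_contra! hlt
    exact himg i hi ((hpre i).Icc_subset ⟨x, hxx, rfl⟩ ⟨y, hy, rfl⟩
      ⟨((hx.2 i hi).2 h).le, hlt⟩)

lemma card_bounded_components {f : ι → Module.Dual ℝ V} {r : ι → ℝ} {G s : Finset ι}
    {C : Set V} (hC : C = {u | (∀ i ∈ G, f i u = r i) ∧ ∀ i ∈ s, f i u ≠ r i}) :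
    Nat.card {R : Set V | (∃ x ∈ C, R = connectedComponentIn C x) ∧ Bornology.IsBounded R} =
      (bddSigns f r G s).card := by
  have hset : {R : Set V | (∃ x ∈ C, R = connectedComponentIn C x) ∧ Bornology.IsBounded R} =
      signRegion f r G s '' (bddSigns f r G s : Set (Finset ι)) := by
    ext R
    constructor
    · rintro ⟨⟨x, hx, rfl⟩, hb⟩
      have hx' := hx
      rw [hC] at hx'
      have hxs : x ∈ signRegion f r G s (s.filter fun i => r i < f i x) := by
        refine ⟨hx'.1, fun i hi => ?_⟩
        simp only [Finset.mem_filter, hi, true_and, imp_self, not_lt]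
        exact fun h => lt_of_le_of_ne h (hx'.2 i hi)
      rw [connectedComponentIn_eq_signRegion hC hxs] at hb ⊢
      refine ⟨_, ?_, rfl⟩
      simp only [bddSigns, Finset.coe_filter, Finset.mem_powerset, Set.mem_ofPred_eq]
      exact ⟨Finset.filter_subset _ _, ⟨x, hxs⟩, (isBounded_signRegion_iff ⟨x, hxs⟩).1 hb⟩
    · rintro ⟨σ, hσ, rfl⟩
      simp only [bddSigns, Finset.coe_filter, Finset.mem_powerset, Set.mem_ofPred_eq] at hσ
      obtain ⟨hσs, ⟨x, hx⟩, hb⟩ := hσ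
      have hcomp := connectedComponentIn_eq_signRegion hC hx
      refine ⟨⟨x, ?_, hcomp.symm⟩, (isBounded_signRegion_iff ⟨x, hx⟩).2 hb⟩
      rw [← hcomp] at hx
      exact connectedComponentIn_subset C x hx
  have hinj : Set.InjOn (signRegion f r G s) (bddSigns f r G s : Set (Finset ι)) := by
    intro σ hσ τ hτ h
    simp only [bddSigns, Finset.coe_filter, Finset.mem_powerset, Set.mem_ofPred_eq] at hσ hτ
    obtain ⟨hσs, ⟨x, hx⟩, -⟩ := hσ
    have hx' : x ∈ signRegion f r G s τ := h ▸ hx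
    ext i
    constructor
    · intro hi
      by_contra hiτ
      exact lt_asymm ((hx.2 i (hσs hi)).1 hi) ((hx'.2 i (hσs hi)).2 hiτ)
    · intro hi
      by_contra hiσ
      exact lt_asymm ((hx'.2 i (hτ.1 hi)).1 hi) ((hx.2 i (hτ.1 hi)).2 hiσ)
  rw [hset, Nat.card_coe_set_eq, hinj.ncard_image, Set.ncard_coe_finset]

end Topology

section BoundedRegions

variable {d n : ℕ} {b : Fin n → Fin d → ℤ} {r : Fin n → ℝ}

/-- The linear functional `u ↦ ⟨u, b i⟩`. -/
def pairing (d n : ℕ) (b : Fin n → Fin d → ℤ) (i : Fin n) : Module.Dual ℝ (Fin d → ℝ) :=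
  dotProductEquiv ℝ (Fin d) (toR d (b i))

lemma pairing_apply (i : Fin n) (u : Fin d → ℝ) :
    pairing d n b i u = ∑ j, u j * (b i j : ℝ) := by
  simp [pairing, dotProduct, toR, mul_comm]

lemma mem_hyperplane_iff {i : Fin n} {u : Fin d → ℝ} :
    u ∈ hyperplane d n b r i ↔ pairing d n b i u = r i := by
  rw [pairing_apply]; rfl

lemma memMatroid_iff (F : Finset (Fin n)) :
    memMatroid d n b F ↔ LinearIndepOn ℝ (fun i => toR d (b i)) (F : Set (Fin n)) := Iff.rfl

lemma linearIndepOn_pairing_iff (F : Finset (Fin n)) :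
    LinearIndepOn ℝ (pairing d n b) (F : Set (Fin n)) ↔ memMatroid d n b F := by
  rw [memMatroid_iff]
  exact LinearMap.linearIndepOn_iff_of_injOn (v := fun i => toR d (b i))
    (dotProductEquiv ℝ (Fin d)).toLinearMap (dotProductEquiv ℝ (Fin d)).injective.injOn

lemma pairing_eq_zero_of_mem_span {F : Finset (Fin n)} {u : Fin d → ℝ}
    (hu : ∀ i ∈ F, pairing d n b i u = 0) {w : Fin d → ℝ} (hw : w ∈ spanF d n b F) :
    dotProductEquiv ℝ (Fin d) w u = 0 := by
  have hle : spanF d n b F ≤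
      LinearMap.ker ((Module.Dual.eval ℝ _ u).comp (dotProductEquiv ℝ (Fin d)).toLinearMap) := by
    rw [spanF, Submodule.span_le]
    rintro _ ⟨i, hi, rfl⟩
    exact hu i hi
  exact hle hw

/-- In a simple arrangement, hyperplanes with a common point have independent normals. -/
lemma Simple.linearIndepOn (hr : Simple d n b r) (F : Finset (Fin n))
    (h : ∃ u, ∀ i ∈ F, pairing d n b i u = r i) :
    LinearIndepOn ℝ (pairing d n b) (F : Set (Fin n)) := by
  obtain ⟨x, hx⟩ := h
  have hmem : ∀ u, u ∈ ⋂ i ∈ F, hyperplane d n b r i ↔ ∀ i ∈ F, pairing d n b i u = r i := by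
    intro u; simp [mem_hyperplane_iff]
  rcases hr F with h | h
  · have := (hmem x).2 hx
    rw [h] at this
    exact this.elim
  · have h := h x ((hmem x).2 hx)
    have himg : ((fun u => u - x) '' ⋂ i ∈ F, hyperplane d n b r i) =
        ((Submodule.span ℝ (pairing d n b '' F)).dualCoannihilator : Set (Fin d → ℝ)) := by
      ext v
      simp only [Set.mem_image, hmem, SetLike.mem_coe, Submodule.mem_dualCoannihilator]
      constructor
      · rintro ⟨u, hu, rfl⟩ φ hφ
        induction hφ using Submodule.span_induction with
        | mem φ hφ =>
          obtain ⟨i, hi, rfl⟩ := hφ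
          rw [map_sub, hu i hi, hx i hi, sub_self]
        | zero => simp
        | add φ ψ _ _ h1 h2 => simp only [LinearMap.add_apply, h1, h2, add_zero]
        | smul a φ _ h1 => simp only [LinearMap.smul_apply, h1, smul_zero]
      · intro hv
        refine ⟨v + x, fun i hi => ?_, by simp⟩
        rw [map_add, hx i hi, hv _ (Submodule.subset_span ⟨i, hi, rfl⟩), zero_add]
    rw [himg, Submodule.span_eq] at h
    have h2 := Subspace.finrank_add_finrank_dualCoannihilator_eq
      (Submodule.span ℝ (pairing d n b '' F))
    simp only [Module.finrank_fintype_fun_eq_card, Fintype.card_fin] at h2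
    have h3 : F.card ≤ Module.finrank ℝ (Submodule.span ℝ (pairing d n b '' F)) := by omega
    rw [LinearIndepOn, linearIndependent_iff_card_le_finrank_span]
    rw [Set.finrank, ← Set.image_eq_range]
    simpa using h3

/-- The vectors of the configuration span `ℝ^d`. -/
lemma eq_zero_of_pairing_eq_zero (hgen : Submodule.span ℤ (Set.range b) = ⊤) {v : Fin d → ℝ}
    (hv : ∀ i, pairing d n b i v = 0) : v = 0 := by
  have h : ∀ z : Fin d → ℤ, ∑ j, v j * (z j : ℝ) = 0 := by
    intro z
    have hz : z ∈ Submodule.span ℤ (Set.range b) := hgen ▸ Submodule.mem_top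
    induction hz using Submodule.span_induction with
    | mem x hx =>
      obtain ⟨i, rfl⟩ := hx
      rw [← pairing_apply, hv]
    | zero => simp
    | add x y _ _ h1 h2 => simp [mul_add, Finset.sum_add_distrib, h1, h2]
    | smul a x _ h1 =>
      have : ∑ j, v j * ((a • x) j : ℝ) = a * ∑ j, v j * (x j : ℝ) := by
        rw [Finset.mul_sum]
        exact Finset.sum_congr rfl fun j _ => by simp; ring
      rw [this, h1, mul_zero]
  ext j
  simpa [Pi.single_apply] using h (Pi.single j 1)

/-- The number of bounded regions of a restriction of a simple arrangement, as an alternating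
sum over the independent sets containing the given one. -/
theorem boundedRegionCount_eq (hgen : Submodule.span ℤ (Set.range b) = ⊤)
    (hr : Simple d n b r) (G : Finset (Fin n)) (hG : memMatroid d n b G) :
    (boundedRegionCount d n b r G : ℤ) = ∑ F : Finset (Fin n),
      if G ⊆ F ∧ memMatroid d n b F then (-1) ^ (d + F.card) else 0 := by
  set s : Finset (Fin n) := Finset.univ.filter fun i => toR d (b i) ∉ spanF d n b G with hs
  have hmem : ∀ i ∈ G, toR d (b i) ∈ spanF d n b G := fun i hi =>
    Submodule.subset_span ⟨i, hi, rfl⟩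
  have hdisj : Disjoint G s := by
    rw [Finset.disjoint_left]
    intro i hi his
    exact (Finset.mem_filter.1 his).2 (hmem i hi)
  have hC : arrComplement d n b r G = {u | (∀ i ∈ G, pairing d n b i u = r i) ∧
      ∀ i ∈ s, pairing d n b i u ≠ r i} := by
    ext u
    simp [arrComplement, flat, mem_hyperplane_iff, hs]
  rw [boundedRegionCount, card_bounded_components hC, card_bddSigns_eq_sum hr.linearIndepOn s G
    ((linearIndepOn_pairing_iff G).2 hG) hdisj fun v h1 h2 =>
      eq_zero_of_pairing_eq_zero hgen fun i => ?_]
  · rw [← Finset.sum_filter, ← Finset.sum_filter]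
    symm
    refine Finset.sum_bij' (fun F _ => F \ G) (fun F _ => G ∪ F) ?_ ?_ ?_ ?_ ?_
    · intro F hF
      obtain ⟨hGF, hF⟩ := (Finset.mem_filter.1 hF).2
      rw [Finset.mem_filter, Finset.mem_powerset, linearIndepOn_pairing_iff,
        Finset.union_sdiff_of_subset hGF]
      refine ⟨fun i hi => ?_, hF⟩
      obtain ⟨hiF, hiG⟩ := Finset.mem_sdiff.1 hi
      refine Finset.mem_filter.2 ⟨Finset.mem_univ _, ?_⟩
      have := ((memMatroid_iff F).1 hF).mono
        (t := (insert i (G : Set (Fin n)))) (Set.insert_subset hiF hGF)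
      exact ((linearIndepOn_insert (by simpa using hiG)).1 this).2
    · intro F hF
      obtain ⟨h1, h2⟩ := Finset.mem_filter.1 hF
      rw [linearIndepOn_pairing_iff] at h2
      simpa using h2
    · intro F hF
      exact Finset.union_sdiff_of_subset (Finset.mem_filter.1 hF).2.1
    · intro F hF
      have := Finset.mem_powerset.1 (Finset.mem_filter.1 hF).1
      exact Finset.union_sdiff_cancel_left (hdisj.mono_right this)
    · intro F hF
      simp [Finset.union_sdiff_of_subset (Finset.mem_filter.1 hF).2.1]
  · by_cases hi : i ∈ s
    · exact h2 i hi
    · have : toR d (b i) ∈ spanF d n b G := by simpa [hs] using hi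
      exact pairing_eq_zero_of_mem_span h1 this

end BoundedRegions
section Zonotope

lemma encard_eq_of_bijOn {α β : Type*} {f : α → β} {s : Set α} {t : Set β}
    (h : Set.BijOn f s t) : s.encard = t.encard := by
  rw [← h.image_eq, h.injOn.encard_image]

/-- The lattice points of the zonotope `∑ i ∈ s, w i • [0, φ (b i)]`. -/
def zonotopePoints {ι Λ V : Type*} [AddCommGroup Λ] [AddCommGroup V] [Module ℝ V] (φ : Λ →+ V)
    (b : ι → Λ) (w : ι → ℕ) (s : Finset ι) : Set Λ :=
  {x | ∃ a : ι → ℝ, (∀ i ∈ s, 0 ≤ a i ∧ a i ≤ w i) ∧ φ x = ∑ i ∈ s, a i • φ (b i)}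

/-- The lattice points of the half-open parallelepiped `∑ i ∈ F, [0, 1) • φ (b i)`. -/
def halfBoxPoints {ι Λ V : Type*} [AddCommGroup Λ] [AddCommGroup V] [Module ℝ V] (φ : Λ →+ V)
    (b : ι → Λ) (F : Finset ι) : Set Λ :=
  {x | ∃ a : ι → ℝ, (∀ i ∈ F, 0 ≤ a i ∧ a i < 1) ∧ φ x = ∑ i ∈ F, a i • φ (b i)}

/-- The map induced by `φ` on the quotients by `b₀` and by a subspace containing `φ b₀`. -/
def quotientHom {Λ V : Type*} [AddCommGroup Λ] [AddCommGroup V] [Module ℝ V] (φ : Λ →+ V)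
    (b₀ : Λ) (N : Submodule ℝ V) (h : φ b₀ ∈ N) : Λ ⧸ AddSubgroup.zmultiples b₀ →+ V ⧸ N :=
  QuotientAddGroup.lift _ (N.mkQ.toAddMonoidHom.comp φ) (by
    rw [AddSubgroup.zmultiples_le]
    simpa [AddMonoidHom.mem_ker] using h)

variable {Λ V : Type*} [AddCommGroup Λ] [AddCommGroup V] [Module ℝ V] {φ : Λ →+ V} {b₀ : Λ}
  {N : Submodule ℝ V}

/-- The lattice points of `Z + [0, m] • φ b₀`. -/
def thickening (φ : Λ →+ V) (b₀ : Λ) (Z : Set V) (m : ℕ) : Set Λ :=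
  {x | ∃ c : ℝ, 0 ≤ c ∧ c ≤ m ∧ φ x - c • φ b₀ ∈ Z}

lemma mem_thickening_succ_diff {Z : Set V} (hZ : Convex ℝ Z) {m : ℕ} {x : Λ} :
    x ∈ thickening φ b₀ Z (m + 1) \ thickening φ b₀ Z m ↔
      (∃ c : ℝ, c ≤ m + 1 ∧ φ x - c • φ b₀ ∈ Z) ∧ ∀ c : ℝ, φ x - c • φ b₀ ∈ Z → (m : ℝ) < c := by
  constructor
  · rintro ⟨⟨c, hc0, hcm, hcZ⟩, hx⟩
    refine ⟨⟨c, by simpa using hcm, hcZ⟩, fun c' hc' => ?_⟩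
    by_contra! hle
    have hmc : (m : ℝ) < c := by
      by_contra! h
      exact hx ⟨c, hc0, h, hcZ⟩
    refine hx ⟨m, Nat.cast_nonneg m, le_rfl, ?_⟩
    have hden : 0 < c - c' := by linarith
    have := hZ hc' hcZ (a := (c - m) / (c - c')) (b := (m - c') / (c - c'))
      (div_nonneg (by linarith) hden.le) (div_nonneg (by linarith) hden.le)
      (by field_simp; ring)
    convert this using 1
    have h1 : (c - m) / (c - c') + (m - c') / (c - c') = 1 := by field_simp; ring
    have h2 : (c - m) / (c - c') * c' + (m - c') / (c - c') * c = m := by field_simp; ring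
    calc φ x - (m : ℝ) • φ b₀ = ((c - m) / (c - c') + (m - c') / (c - c')) • φ x -
          ((c - m) / (c - c') * c' + (m - c') / (c - c') * c) • φ b₀ := by rw [h1, h2, one_smul]
      _ = _ := by module
  · rintro ⟨⟨c, hc, hcZ⟩, hx⟩
    have := hx c hcZ
    refine ⟨⟨c, (Nat.cast_nonneg m).trans this.le, by simpa using hc, hcZ⟩, ?_⟩
    rintro ⟨c', -, hc', hcZ'⟩
    linarith [hx c' hcZ']

lemma exists_sub_smul_mem_of_mem_image (hN : N = Submodule.span ℝ {φ b₀}) {Z : Set V} {x : Λ}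
    (h : N.mkQ (φ x) ∈ N.mkQ '' Z) : ∃ c : ℝ, φ x - c • φ b₀ ∈ Z := by
  obtain ⟨z, hz, hzx⟩ := h
  have hmem : φ x - z ∈ N := by
    rw [← Submodule.ker_mkQ N, LinearMap.mem_ker, map_sub, hzx, sub_self]
  rw [hN, Submodule.mem_span_singleton] at hmem
  obtain ⟨c, hc⟩ := hmem
  exact ⟨c, by rwa [hc, sub_sub_cancel]⟩

lemma mkQ_mem_image_of_sub_smul_mem (h : φ b₀ ∈ N) {Z : Set V} {x : Λ} {c : ℝ}
    (hc : φ x - c • φ b₀ ∈ Z) : N.mkQ (φ x) ∈ N.mkQ '' Z := by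
  refine ⟨_, hc, ?_⟩
  rw [map_sub, sub_eq_self, ← LinearMap.mem_ker, Submodule.ker_mkQ]
  exact N.smul_mem c h

lemma exists_zsmul_of_mk_eq {x y : Λ}
    (h : (QuotientAddGroup.mk x : Λ ⧸ AddSubgroup.zmultiples b₀) = QuotientAddGroup.mk y) :
    ∃ k : ℤ, y = x + k • b₀ := by
  rw [QuotientAddGroup.eq, AddSubgroup.mem_zmultiples_iff] at h
  obtain ⟨k, hk⟩ := h
  exact ⟨k, by rw [hk]; abel⟩

lemma map_add_zsmul_sub_smul (x : Λ) (k : ℤ) (c : ℝ) :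
    φ (x + k • b₀) - c • φ b₀ = φ x - (c - k) • φ b₀ := by
  rw [map_add, map_zsmul, sub_smul, Int.cast_smul_eq_zsmul]
  abel

/-- Each lattice line meeting `Z` gains exactly one point when thickening by one more step. -/
lemma bijOn_thickening_succ_diff (h : φ b₀ ∈ N) (hN : N = Submodule.span ℝ {φ b₀})
    {Z : Set V} (hZ : Convex ℝ Z) (hbdd : ∃ g : Module.Dual ℝ V, g (φ b₀) = 1 ∧
      ∃ M : ℝ, ∀ z ∈ Z, g z ≤ M) (m : ℕ) :
    Set.BijOn (QuotientAddGroup.mk : Λ → Λ ⧸ AddSubgroup.zmultiples b₀)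
      (thickening φ b₀ Z (m + 1) \ thickening φ b₀ Z m)
      {y | quotientHom φ b₀ N h y ∈ N.mkQ '' Z} := by
  refine ⟨fun x hx => ?_, fun x hx y hy hxy => ?_, fun y hy => ?_⟩
  · obtain ⟨⟨c, -, -, hc⟩, -⟩ := hx
    exact mkQ_mem_image_of_sub_smul_mem h hc
  · rw [mem_thickening_succ_diff hZ] at hx hy
    obtain ⟨k, rfl⟩ := exists_zsmul_of_mk_eq hxy
    obtain ⟨⟨c, hc, hcZ⟩, hx⟩ := hx
    obtain ⟨⟨c', hc', hcZ'⟩, hy⟩ := hy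
    have h1 := hx _ (map_add_zsmul_sub_smul (φ := φ) (b₀ := b₀) x k c' ▸ hcZ')
    have h2 := hy (c + k) (by rwa [map_add_zsmul_sub_smul, add_sub_cancel_right])
    have h3 : (k : ℝ) < 1 := by linarith
    have h4 : (-1 : ℝ) < k := by linarith
    have h5 : k < 1 := by exact_mod_cast h3
    have h6 : -1 < k := by exact_mod_cast h4
    have : k = 0 := by omega
    simp [this]
  · obtain ⟨x, rfl⟩ := QuotientAddGroup.mk_surjective y
    obtain ⟨c₀, hc₀⟩ := exists_sub_smul_mem_of_mem_image (φ := φ) (x := x) hN hy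
    obtain ⟨g, hg, M, hM⟩ := hbdd
    have hlow : ∀ c : ℝ, φ x - c • φ b₀ ∈ Z → g (φ x) - M ≤ c := fun c hc => by
      have := hM _ hc
      rw [map_sub, map_smul, hg, smul_eq_mul, mul_one] at this
      linarith
    obtain ⟨k, hk, hmin⟩ := Int.exists_least_of_bdd
      (P := fun k : ℤ => ∀ c : ℝ, φ x - c • φ b₀ ∈ Z → (m : ℝ) < c + k)
      ⟨⌊m - c₀⌋, fun k hk => Int.floor_le_iff.2 (by linarith [hk c₀ hc₀])⟩
      ⟨⌊m - (g (φ x) - M)⌋ + 1, fun c hc => by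
        have := hlow c hc
        have := Int.lt_floor_add_one (m - (g (φ x) - M))
        push_cast
        linarith⟩
    refine ⟨x + k • b₀, (mem_thickening_succ_diff hZ).2 ⟨?_, fun c hc => ?_⟩, ?_⟩
    · by_contra! hcon
      have := hmin (k - 1) fun c hc => by
        by_contra! hle
        refine hcon (c + k) ?_ (by rwa [map_add_zsmul_sub_smul, add_sub_cancel_right])
        push_cast at hle
        linarith
      omega
    · have := hk _ (map_add_zsmul_sub_smul (φ := φ) (b₀ := b₀) x k c ▸ hc)
      linarith
    · rw [QuotientAddGroup.eq]
      simp [AddSubgroup.mem_zmultiples_iff]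

lemma encard_thickening (h : φ b₀ ∈ N) (hN : N = Submodule.span ℝ {φ b₀})
    {Z : Set V} (hZ : Convex ℝ Z) (hbdd : ∃ g : Module.Dual ℝ V, g (φ b₀) = 1 ∧
      ∃ M : ℝ, ∀ z ∈ Z, g z ≤ M) (m : ℕ) :
    (thickening φ b₀ Z m).encard = (thickening φ b₀ Z 0).encard +
      m * {y | quotientHom φ b₀ N h y ∈ N.mkQ '' Z}.encard := by
  induction m with
  | zero => simp
  | succ m ih =>
    have hsub : thickening φ b₀ Z m ⊆ thickening φ b₀ Z (m + 1) := by
      rintro x ⟨c, h0, h1, h2⟩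
      exact ⟨c, h0, by push_cast; linarith, h2⟩
    rw [← Set.encard_sdiff_add_encard_of_subset hsub,
      encard_eq_of_bijOn (bijOn_thickening_succ_diff h hN hZ hbdd m), ih]
    push_cast
    ring

/-- Projection along `b₀` of a half-open thickening is bijective when `φ b₀` is transverse. -/
lemma bijOn_halfOpen (h : φ b₀ ∈ N) (hN : N = Submodule.span ℝ {φ b₀}) {Z : Set V}
    (huniq : ∀ (v : V) (c c' : ℝ), v - c • φ b₀ ∈ Z → v - c' • φ b₀ ∈ Z → c = c') :
    Set.BijOn (QuotientAddGroup.mk : Λ → Λ ⧸ AddSubgroup.zmultiples b₀)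
      {x | ∃ c : ℝ, 0 ≤ c ∧ c < 1 ∧ φ x - c • φ b₀ ∈ Z}
      {y | quotientHom φ b₀ N h y ∈ N.mkQ '' Z} := by
  refine ⟨fun x hx => ?_, fun x hx y hy hxy => ?_, fun y hy => ?_⟩
  · obtain ⟨c, -, -, hc⟩ := hx
    exact mkQ_mem_image_of_sub_smul_mem h hc
  · obtain ⟨k, rfl⟩ := exists_zsmul_of_mk_eq hxy
    obtain ⟨c, hc0, hc1, hc⟩ := hx
    obtain ⟨c', hc0', hc1', hc'⟩ := hy
    have := huniq _ _ _ hc (map_add_zsmul_sub_smul (φ := φ) (b₀ := b₀) x k c' ▸ hc')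
    have h3 : (k : ℝ) < 1 := by linarith
    have h4 : (-1 : ℝ) < k := by linarith
    have h5 : k < 1 := by exact_mod_cast h3
    have h6 : -1 < k := by exact_mod_cast h4
    have : k = 0 := by omega
    simp [this]
  · obtain ⟨x, rfl⟩ := QuotientAddGroup.mk_surjective y
    obtain ⟨c, hc⟩ := exists_sub_smul_mem_of_mem_image (φ := φ) (x := x) hN hy
    refine ⟨x + (-⌊c⌋) • b₀, ⟨Int.fract c, Int.fract_nonneg c, Int.fract_lt_one c, ?_⟩, ?_⟩
    · rw [map_add_zsmul_sub_smul]
      convert hc using 3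
      push_cast
      rw [sub_neg_eq_add, Int.fract_add_floor]
    · rw [QuotientAddGroup.eq]
      simp [AddSubgroup.mem_zmultiples_iff]

end Zonotope

section ZonotopeCount

lemma mkQ_mem_image_sum_iff {ι V : Type*} [AddCommGroup V] [Module ℝ V] {f : ι → V}
    {s : Finset ι} (N : Submodule ℝ V) (p : ι → ℝ → Prop) (v : V ⧸ N) :
    v ∈ N.mkQ '' {z | ∃ a : ι → ℝ, (∀ j ∈ s, p j (a j)) ∧ z = ∑ j ∈ s, a j • f j} ↔
      ∃ a : ι → ℝ, (∀ j ∈ s, p j (a j)) ∧ v = ∑ j ∈ s, a j • N.mkQ (f j) := by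
  constructor
  · rintro ⟨_, ⟨a, ha, rfl⟩, rfl⟩
    exact ⟨a, ha, by simp only [map_sum, map_smul]⟩
  · rintro ⟨a, ha, rfl⟩
    exact ⟨_, ⟨a, ha, rfl⟩, by simp only [map_sum, map_smul]⟩

variable {ι : Type*} [DecidableEq ι]

lemma mem_sum_insert_iff {V : Type*} [AddCommGroup V] [Module ℝ V] {f : ι → V} {i : ι}
    {s : Finset ι} (hi : i ∉ s) (p : ι → ℝ → Prop) (v : V) :
    (∃ a : ι → ℝ, (∀ j ∈ insert i s, p j (a j)) ∧ v = ∑ j ∈ insert i s, a j • f j) ↔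
      ∃ c, p i c ∧ v - c • f i ∈
        {z | ∃ a : ι → ℝ, (∀ j ∈ s, p j (a j)) ∧ z = ∑ j ∈ s, a j • f j} := by
  constructor
  · rintro ⟨a, ha, rfl⟩
    refine ⟨a i, ha i (Finset.mem_insert_self i s), a,
      fun j hj => ha j (Finset.mem_insert_of_mem hj), ?_⟩
    rw [Finset.sum_insert hi, add_sub_cancel_left]
  · rintro ⟨c, hc, a, ha, h⟩
    have hne : ∀ j ∈ s, j ≠ i := fun j hj h => hi (h ▸ hj)
    refine ⟨Function.update a i c, (Finset.forall_mem_insert _ _ _).2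
      ⟨by simpa using hc, fun j hj => by simpa [hne j hj] using ha j hj⟩, ?_⟩
    rw [Finset.sum_insert hi, Function.update_self, ← sub_eq_iff_eq_add', h]
    exact Finset.sum_congr rfl fun j hj => by rw [Function.update_of_ne (hne j hj)]

variable {Λ V : Type*} [AddCommGroup Λ] [AddCommGroup V] [Module ℝ V]

lemma encard_zonotopePoints_insert (φ : Λ →+ V) (b : ι → Λ) (w : ι → ℕ) {s : Finset ι} {i : ι}
    (hi : i ∉ s) (hbi : φ (b i) ≠ 0) {N : Submodule ℝ V} (h : φ (b i) ∈ N)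
    (hN : N = Submodule.span ℝ {φ (b i)}) :
    (zonotopePoints φ b w (insert i s)).encard = (zonotopePoints φ b w s).encard +
      w i * (zonotopePoints (quotientHom φ (b i) N h) (fun j => QuotientAddGroup.mk (b j)) w
        s).encard := by
  set Z : Set V :=
    {z | ∃ a : ι → ℝ, (∀ j ∈ s, 0 ≤ a j ∧ a j ≤ w j) ∧ z = ∑ j ∈ s, a j • φ (b j)} with hZdef
  have hZ : Convex ℝ Z := by
    rintro _ ⟨a, ha, rfl⟩ _ ⟨a', ha', rfl⟩ t t' ht ht' htt
    refine ⟨fun j => t * a j + t' * a' j, fun j hj => ⟨?_, ?_⟩, ?_⟩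
    · exact add_nonneg (mul_nonneg ht (ha j hj).1) (mul_nonneg ht' (ha' j hj).1)
    · calc t * a j + t' * a' j ≤ t * w j + t' * w j :=
          add_le_add (mul_le_mul_of_nonneg_left (ha j hj).2 ht)
            (mul_le_mul_of_nonneg_left (ha' j hj).2 ht')
        _ = w j := by rw [← add_mul, htt, one_mul]
    · simp only [Finset.smul_sum, smul_smul, add_smul, Finset.sum_add_distrib]
  have hbdd : ∃ g : Module.Dual ℝ V, g (φ (b i)) = 1 ∧ ∃ M : ℝ, ∀ z ∈ Z, g z ≤ M := by
    obtain ⟨g, hg⟩ : ∃ g : Module.Dual ℝ V, g (φ (b i)) ≠ 0 := by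
      by_contra! hcon
      exact hbi ((Module.forall_dual_apply_eq_zero_iff ℝ _).1 hcon)
    refine ⟨(g (φ (b i)))⁻¹ • g, by simp [hg], ∑ j ∈ s, w j * |((g (φ (b i)))⁻¹ • g) (φ (b j))|, ?_⟩
    rintro _ ⟨a, ha, rfl⟩
    rw [map_sum]
    refine Finset.sum_le_sum fun j hj => ?_
    rw [map_smul, smul_eq_mul]
    exact (mul_le_mul_of_nonneg_left (le_abs_self _) (ha j hj).1).trans
      (mul_le_mul_of_nonneg_right (ha j hj).2 (abs_nonneg _))
  have h1 : zonotopePoints φ b w (insert i s) = thickening φ (b i) Z (w i) := by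
    ext x
    simp only [zonotopePoints, thickening, Set.mem_ofPred_eq]
    rw [mem_sum_insert_iff hi (fun j c => 0 ≤ c ∧ c ≤ w j)]
    simp only [and_assoc, hZdef]
  have h2 : zonotopePoints φ b w s = thickening φ (b i) Z 0 := by
    ext x
    simp only [thickening, Set.mem_ofPred_eq, Nat.cast_zero]
    constructor
    · intro hx
      exact ⟨0, le_rfl, le_rfl, by rw [zero_smul, sub_zero]; exact hx⟩
    · rintro ⟨c, hc0, hc1, hx⟩
      obtain rfl := le_antisymm hc1 hc0
      rw [zero_smul, sub_zero] at hx
      exact hx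
  have h3 : zonotopePoints (quotientHom φ (b i) N h) (fun j => QuotientAddGroup.mk (b j)) w s =
      {y | quotientHom φ (b i) N h y ∈ N.mkQ '' Z} := by
    ext y
    exact (mkQ_mem_image_sum_iff N (fun j c => 0 ≤ c ∧ c ≤ w j) _).symm
  rw [h1, h2, h3, encard_thickening h hN hZ hbdd]

lemma encard_halfBoxPoints_insert (φ : Λ →+ V) (b : ι → Λ) {F : Finset ι} {i : ι}
    (hi : i ∉ F) (hbi : φ (b i) ∉ Submodule.span ℝ ((fun j => φ (b j)) '' F))
    {N : Submodule ℝ V} (h : φ (b i) ∈ N) (hN : N = Submodule.span ℝ {φ (b i)}) :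
    (halfBoxPoints φ b (insert i F)).encard =
      (halfBoxPoints (quotientHom φ (b i) N h) (fun j => QuotientAddGroup.mk (b j)) F).encard := by
  set Z : Set V :=
    {z | ∃ a : ι → ℝ, (∀ j ∈ F, 0 ≤ a j ∧ a j < 1) ∧ z = ∑ j ∈ F, a j • φ (b j)} with hZdef
  have hZ : ∀ z ∈ Z, z ∈ Submodule.span ℝ ((fun j => φ (b j)) '' F) := by
    rintro _ ⟨a, -, rfl⟩
    exact Submodule.sum_mem _ fun j hj => Submodule.smul_mem _ _
      (Submodule.subset_span ⟨j, hj, rfl⟩)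
  have huniq : ∀ (v : V) (c c' : ℝ), v - c • φ (b i) ∈ Z → v - c' • φ (b i) ∈ Z → c = c' := by
    intro v c c' hc hc'
    by_contra hne
    have hsub := Submodule.sub_mem _ (hZ _ hc') (hZ _ hc)
    have heq : v - c' • φ (b i) - (v - c • φ (b i)) = (c - c') • φ (b i) := by module
    rw [heq, Submodule.smul_mem_iff _ (sub_ne_zero.2 hne)] at hsub
    exact hbi hsub
  have h1 : halfBoxPoints φ b (insert i F) =
      {x | ∃ c : ℝ, 0 ≤ c ∧ c < 1 ∧ φ x - c • φ (b i) ∈ Z} := by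
    ext x
    simp only [halfBoxPoints, Set.mem_ofPred_eq]
    rw [mem_sum_insert_iff hi (fun _ c => 0 ≤ c ∧ c < 1)]
    simp only [and_assoc, hZdef]
  have h3 : halfBoxPoints (quotientHom φ (b i) N h) (fun j => QuotientAddGroup.mk (b j)) F =
      {y | quotientHom φ (b i) N h y ∈ N.mkQ '' Z} := by
    ext y
    exact (mkQ_mem_image_sum_iff N (fun _ c => 0 ≤ c ∧ c < 1) _).symm
  rw [h1, h3, encard_eq_of_bijOn (bijOn_halfOpen h hN huniq)]

end ZonotopeCount

/-- Lattice points of a zonotope are counted by half-open parallelepipeds over the independent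
subsets of the generators. -/
theorem encard_zonotopePoints {ι : Type*} [DecidableEq ι] (w : ι → ℕ) (s : Finset ι) :
    ∀ {Λ : Type*} {V : Type*} [AddCommGroup Λ] [AddCommGroup V] [Module ℝ V] (φ : Λ →+ V)
      (b : ι → Λ), (zonotopePoints φ b w s).encard = ∑ F ∈ s.powerset,
        if LinearIndepOn ℝ (fun i => φ (b i)) (F : Set ι) then
          (∏ i ∈ F, (w i : ℕ∞)) * (halfBoxPoints φ b F).encard else 0 := by
  induction s using Finset.induction_on with
  | empty =>
    intro Λ V _ _ _ φ b
    simp [zonotopePoints, halfBoxPoints]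
  | insert i s hi ih =>
    intro Λ V _ _ _ φ b
    rw [Finset.sum_powerset_insert hi]
    by_cases hbi : φ (b i) = 0
    · have h1 : zonotopePoints φ b w (insert i s) = zonotopePoints φ b w s := by
        ext x
        simp only [zonotopePoints, Set.mem_ofPred_eq]
        rw [mem_sum_insert_iff hi (fun j c => 0 ≤ c ∧ c ≤ w j)]
        simp only [hbi, smul_zero, sub_zero, Set.mem_ofPred_eq]
        exact ⟨fun ⟨_, _, h⟩ => h, fun h => ⟨0, ⟨le_rfl, Nat.cast_nonneg _⟩, h⟩⟩
      rw [h1, ih φ b, Finset.sum_eq_zero (f := fun F => if LinearIndepOn ℝ (fun i => φ (b i))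
        ((insert i F : Finset ι) : Set ι) then _ else _), add_zero]
      intro F _
      rw [if_neg]
      intro hind
      exact hind.ne_zero (by simp : i ∈ ((insert i F : Finset ι) : Set ι)) hbi
    · set N := Submodule.span ℝ ((fun j => φ (b j)) '' {i}) with hNdef
      have hN : N = Submodule.span ℝ {φ (b i)} := by rw [hNdef, Set.image_singleton]
      have h : φ (b i) ∈ N := hN ▸ Submodule.mem_span_singleton_self _
      rw [encard_zonotopePoints_insert φ b w hi hbi h hN, ih φ b, ih (quotientHom φ (b i) N h),
        Finset.mul_sum]
      congr 1
      refine Finset.sum_congr rfl fun F hF => ?_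
      have hiF : i ∉ F := fun h' => hi (Finset.mem_powerset.1 hF h')
      have hiff : LinearIndepOn ℝ (fun j => φ (b j)) ((insert i F : Finset ι) : Set ι) ↔
          LinearIndepOn ℝ (fun j => quotientHom φ (b i) N h (QuotientAddGroup.mk (b j)))
            (F : Set ι) := by
        rw [Finset.coe_insert, Set.insert_eq, linearIndepOn_union_iff_quotient
          (by simpa using hiF), and_iff_right
            (LinearIndepOn.singleton (v := fun j => φ (b j)) hbi)]
        rfl
      by_cases hind : LinearIndepOn ℝ (fun j => φ (b j)) ((insert i F : Finset ι) : Set ι)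
      · rw [if_pos hind, if_pos (hiff.1 hind), Finset.prod_insert hiF]
        rw [Finset.coe_insert, linearIndepOn_insert (by simpa using hiF)] at hind
        rw [encard_halfBoxPoints_insert φ b hiF hind.2 h hN, mul_assoc]
      · rw [if_neg hind, if_neg (fun h' => hind (hiff.2 h')), mul_zero]

section LatticeCount

variable {d n : ℕ} {b : Fin n → Fin d → ℤ}

/-- The inclusion of `ℤ^d` in `ℝ^d`. -/
def toRHom (d : ℕ) : (Fin d → ℤ) →+ (Fin d → ℝ) where
  toFun := toR d
  map_zero' := by ext j; simp [toR]
  map_add' x y := by ext j; simp [toR]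

lemma finite_box (F : Finset (Fin n)) : {z : Fin d → ℤ | toR d z ∈ box d n b F}.Finite := by
  refine (Set.finite_Icc (fun j => -∑ i ∈ F, |b i j|) (fun j => ∑ i ∈ F, |b i j|)).subset ?_
  rintro z ⟨a, ha, hz⟩
  have habs : ∀ j, |z j| ≤ ∑ i ∈ F, |b i j| := fun j => by
    have hzj : (z j : ℝ) = ∑ i ∈ F, a i * b i j := by
      simpa [toR, Finset.sum_apply] using congrFun hz j
    have : |(z j : ℝ)| ≤ ∑ i ∈ F, |(b i j : ℝ)| := by
      rw [hzj]
      refine (Finset.abs_sum_le_sum_abs _ _).trans (Finset.sum_le_sum fun i hi => ?_)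
      rw [abs_mul, abs_of_pos (ha i hi).1]
      exact mul_le_of_le_one_left (abs_nonneg _) (ha i hi).2.le
    exact_mod_cast this
  exact ⟨fun j => (abs_le.1 (habs j)).1, fun j => (abs_le.1 (habs j)).2⟩

lemma mem_halfBoxPoints_iff {F : Finset (Fin n)} {z : Fin d → ℤ} :
    z ∈ halfBoxPoints (toRHom d) b F ↔ ∃ G ⊆ F, toR d z ∈ box d n b G := by
  constructor
  · rintro ⟨a, ha, hz⟩
    refine ⟨F.filter fun i => a i ≠ 0, Finset.filter_subset _ _, a, fun i hi => ?_, ?_⟩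
    · rw [Finset.mem_filter] at hi
      exact ⟨(ha i hi.1).1.lt_of_ne' hi.2, (ha i hi.1).2⟩
    · rw [Finset.sum_filter_of_ne (p := fun i => a i ≠ 0) fun i _ h h0 => h (by
        rw [h0, zero_smul])]
      exact hz
  · rintro ⟨G, hG, a, ha, hz⟩
    refine ⟨fun i => if i ∈ G then a i else 0, fun i _ => ?_, hz.trans ?_⟩
    · by_cases hi : i ∈ G
      · simpa [hi] using ⟨(ha i hi).1.le, (ha i hi).2⟩
      · simp [hi]
    · rw [← Finset.sum_subset hG fun i _ hi => by simp [hi]]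
      exact Finset.sum_congr rfl fun i hi => by simp [hi]; rfl

lemma eq_of_mem_box {F G G' : Finset (Fin n)} (hF : memMatroid d n b F) (hG : G ⊆ F)
    (hG' : G' ⊆ F) {x : Fin d → ℝ} (h : x ∈ box d n b G) (h' : x ∈ box d n b G') : G = G' := by
  obtain ⟨a, ha, hx⟩ := h
  obtain ⟨a', ha', hx'⟩ := h'
  have hsum : ∀ {H : Finset (Fin n)} (c : Fin n → ℝ), H ⊆ F →
      ∑ i ∈ H, c i • toR d (b i) = ∑ i ∈ F, (if i ∈ H then c i else 0) • toR d (b i) := by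
    intro H c hH
    rw [← Finset.sum_subset hH fun i _ hi => by simp [hi]]
    exact Finset.sum_congr rfl fun i hi => by simp [hi]
  have hzero := (linearIndepOn_finset_iff.1 (memMatroid_iff F |>.1 hF))
    (fun i => (if i ∈ G then a i else 0) - (if i ∈ G' then a' i else 0)) (by
      simp only [sub_smul, Finset.sum_sub_distrib]
      rw [← hsum a hG, ← hsum a' hG', ← hx, ← hx', sub_self])
  ext i
  constructor
  · intro hi
    by_contra hi'
    have := hzero i (hG hi)
    simp only [hi, hi', if_true, if_false, sub_zero] at this
    exact (ha i hi).1.ne' this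
  · intro hi
    by_contra hi'
    have := hzero i (hG' hi)
    simp only [hi, hi', if_true, if_false, zero_sub, neg_eq_zero] at this
    exact (ha' i hi).1.ne' this

lemma encard_halfBoxPoints {F : Finset (Fin n)} (hF : memMatroid d n b F) :
    (halfBoxPoints (toRHom d) b F).encard =
      ((∑ G ∈ F.powerset, boxCount d n b G : ℕ) : ℕ∞) := by
  have h : halfBoxPoints (toRHom d) b F =
      (F.powerset.biUnion fun G => (finite_box (b := b) G).toFinset : Finset (Fin d → ℤ)) := by
    ext z
    simp [mem_halfBoxPoints_iff]
  rw [h, Set.encard_coe_eq_coe_finsetCard, Finset.card_biUnion]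
  · congr 1
    refine Finset.sum_congr rfl fun G _ => ?_
    rw [boxCount, ← Set.ncard_eq_toFinset_card _ (finite_box G)]
    rfl
  · intro G hG G' hG' hne
    refine Finset.disjoint_left.2 fun z hz hz' => hne ?_
    exact eq_of_mem_box hF (Finset.mem_powerset.1 hG) (Finset.mem_powerset.1 hG')
      (by simpa using hz) (by simpa using hz')

lemma encard_zonotopePoints_toRHom (b : Fin n → Fin d → ℤ) (w : Fin n → ℕ) :
    (zonotopePoints (toRHom d) b w Finset.univ).encard =
      ((∑ F : Finset (Fin n), if memMatroid d n b F then
        (∏ i ∈ F, w i) * ∑ G ∈ F.powerset, boxCount d n b G else 0 : ℕ) : ℕ∞) := by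
  rw [encard_zonotopePoints, Finset.powerset_univ]
  push_cast
  refine Finset.sum_congr rfl fun F _ => ?_
  by_cases hF : memMatroid d n b F
  · rw [if_pos hF, if_pos (show LinearIndepOn ℝ (fun i => toRHom d (b i)) (F : Set (Fin n))
      from hF),
      encard_halfBoxPoints hF]
    push_cast
    rfl
  · rw [if_neg hF, if_neg (show ¬ LinearIndepOn ℝ (fun i => toRHom d (b i)) (F : Set (Fin n))
      from hF)]

lemma mem_lawrencePolytope_iff {x : Fin d → ℝ} {y : Fin n → ℝ} :
    (x, y) ∈ lawrencePolytope d n b ↔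
      ∃ a : Fin n → ℝ, (∀ i, 0 ≤ a i ∧ a i ≤ y i) ∧ x = ∑ i, a i • toR d (b i) ∧
        ∑ i, y i = 1 := by
  constructor
  · intro h
    let K : Set ((Fin d → ℝ) × (Fin n → ℝ)) := {p | ∃ a : Fin n → ℝ,
      (∀ i, 0 ≤ a i ∧ a i ≤ p.2 i) ∧ p.1 = ∑ i, a i • toR d (b i) ∧ ∑ i, p.2 i = 1}
    have hK : Convex ℝ K := by
      rintro ⟨x, y⟩ ⟨a, ha, hx, hy⟩ ⟨x', y'⟩ ⟨a', ha', hx', hy'⟩ t t' ht ht' htt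
      dsimp only at ha hx hy ha' hx' hy'
      refine ⟨t • a + t' • a', fun i => ⟨?_, ?_⟩, ?_, ?_⟩
      · exact add_nonneg (mul_nonneg ht (ha i).1) (mul_nonneg ht' (ha' i).1)
      · exact add_le_add (mul_le_mul_of_nonneg_left (ha i).2 ht)
          (mul_le_mul_of_nonneg_left (ha' i).2 ht')
      · simp [hx, hx', Finset.smul_sum, add_smul, Finset.sum_add_distrib, mul_smul]
      · simp [Finset.sum_add_distrib, ← Finset.mul_sum, hy, hy', htt]
    refine convexHull_min ?_ hK h
    rintro _ (⟨i, rfl⟩ | ⟨i, rfl⟩)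
    · refine ⟨e n i, fun j => ⟨?_, le_rfl⟩, ?_, by simp [e]⟩
      · by_cases hj : j = i <;> simp [e, hj]
      · simp [e, Pi.single_apply]
    · refine ⟨0, fun j => ⟨le_rfl, ?_⟩, by simp, by simp [e]⟩
      by_cases hj : j = i <;> simp [e, hj]
  · rintro ⟨a, ha, rfl, hy⟩
    have hmem := (convex_convexHull ℝ ((Set.range fun i => (toR d (b i), e n i)) ∪
      (Set.range fun i => ((0 : Fin d → ℝ), e n i)))).sum_mem
      (t := (Finset.univ : Finset (Fin n ⊕ Fin n))) (w := Sum.elim a (y - a))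
      (z := Sum.elim (fun i => (toR d (b i), e n i)) (fun i => ((0 : Fin d → ℝ), e n i)))
      (by
        rintro (i | i) -
        · exact (ha i).1
        · exact sub_nonneg.2 (ha i).2)
      (by simp [hy])
      (by
        rintro (i | i) -
        · exact subset_convexHull ℝ _ (Or.inl ⟨i, rfl⟩)
        · exact subset_convexHull ℝ _ (Or.inr ⟨i, rfl⟩))
    rw [lawrencePolytope]
    convert hmem using 1
    refine Prod.ext ?_ ?_
    · simp [Prod.fst_sum]
    · ext j
      simp [Prod.snd_sum, e, Pi.single_apply, Finset.sum_apply]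

lemma mem_smul_lawrencePolytope_iff (hn : 0 < n) {m : ℕ} {x : Fin d → ℝ} {y : Fin n → ℝ} :
    (x, y) ∈ (m : ℝ) • lawrencePolytope d n b ↔
      ∃ a : Fin n → ℝ, (∀ i, 0 ≤ a i ∧ a i ≤ y i) ∧ x = ∑ i, a i • toR d (b i) ∧
        ∑ i, y i = m := by
  rcases m.eq_zero_or_pos with rfl | hm
  · have hne : (lawrencePolytope d n b).Nonempty :=
      ⟨_, subset_convexHull ℝ _ (Or.inl ⟨⟨0, hn⟩, rfl⟩)⟩
    rw [Nat.cast_zero, Set.zero_smul_set hne, Set.mem_zero, Prod.mk_eq_zero]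
    constructor
    · rintro ⟨rfl, rfl⟩
      exact ⟨0, by simp, by simp, by simp⟩
    · rintro ⟨a, ha, rfl, hy⟩
      have hy0 : ∀ i, y i = 0 := fun i =>
        (Finset.sum_eq_zero_iff_of_nonneg fun i _ => (ha i).1.trans (ha i).2).1 hy i
          (Finset.mem_univ i)
      refine ⟨Finset.sum_eq_zero fun i _ => ?_, funext hy0⟩
      rw [le_antisymm ((ha i).2.trans (hy0 i).le) (ha i).1, zero_smul]
  · have hm' : (0 : ℝ) < m := by exact_mod_cast hm
    rw [Set.mem_smul_set_iff_inv_smul_mem₀ hm'.ne', Prod.smul_mk, mem_lawrencePolytope_iff]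
    constructor
    · rintro ⟨a, ha, hx, hy⟩
      refine ⟨(m : ℝ) • a, fun i => ⟨mul_nonneg hm'.le (ha i).1, ?_⟩, ?_, ?_⟩
      · have := mul_le_mul_of_nonneg_left (ha i).2 hm'.le
        simpa [hm'.ne'] using this
      · rw [inv_smul_eq_iff₀ hm'.ne'] at hx
        simp [hx, Finset.smul_sum, smul_smul]
      · simp only [Pi.smul_apply, smul_eq_mul, ← Finset.mul_sum] at hy
        field_simp at hy
        exact hy
    · rintro ⟨a, ha, rfl, hy⟩
      refine ⟨(m : ℝ)⁻¹ • a, fun i => ⟨mul_nonneg (by positivity) (ha i).1,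
        mul_le_mul_of_nonneg_left (ha i).2 (by positivity)⟩, ?_, ?_⟩
      · simp [Finset.smul_sum, smul_smul]
      · simp only [Pi.smul_apply, smul_eq_mul, ← Finset.mul_sum, hy]
        field_simp

/-- The lattice points of the `m`-th dilate of the Lawrence polytope, grouped by their last `n`
coordinates. -/
def lawrenceFiberMap (hn : 0 < n) (b : Fin n → Fin d → ℤ) (m : ℕ)
    (p : Σ w : {w // w ∈ Finset.finsuppAntidiag (Finset.univ : Finset (Fin n)) m},
      zonotopePoints (toRHom d) b w.1 Finset.univ) :
    {z : (Fin d → ℤ) × (Fin n → ℤ) |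
      (toR d z.1, fun j => (z.2 j : ℝ)) ∈ (m : ℝ) • lawrencePolytope d n b} :=
  ⟨(p.2.1, fun i => (p.1.1 i : ℤ)), by
    obtain ⟨⟨w, hw⟩, x, a, ha, hx⟩ := p
    rw [Finset.mem_finsuppAntidiag] at hw
    refine (mem_smul_lawrencePolytope_iff hn).2 ⟨a, by simpa using ha, hx, ?_⟩
    have h : ((∑ i, w i : ℕ) : ℝ) = m := congrArg Nat.cast hw.1
    simpa using h⟩

lemma lawrenceFiberMap_bijective (hn : 0 < n) (b : Fin n → Fin d → ℤ) (m : ℕ) :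
    Function.Bijective (lawrenceFiberMap hn b m) := by
  constructor
  · rintro ⟨⟨w, hw⟩, x, hx⟩ ⟨⟨w', hw'⟩, x', hx'⟩ h
    simp only [lawrenceFiberMap, Subtype.mk.injEq, Prod.mk.injEq] at h
    obtain ⟨rfl, h⟩ := h
    obtain rfl : w = w' := by
      ext i
      exact_mod_cast congrFun h i
    rfl
  · rintro ⟨⟨x, y⟩, h⟩
    obtain ⟨a, ha, hx, hy⟩ := (mem_smul_lawrencePolytope_iff hn).1 h
    have hy0 : ∀ i, 0 ≤ y i := fun i => by exact_mod_cast (ha i).1.trans (ha i).2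
    have hcast : ∀ i, (((y i).toNat : ℕ) : ℝ) = y i := fun i => by
      exact_mod_cast congrArg (Int.cast : ℤ → ℝ) (Int.toNat_of_nonneg (hy0 i))
    refine ⟨⟨⟨Finsupp.equivFunOnFinite.symm fun i => (y i).toNat, ?_⟩, x, a, ?_, hx⟩, ?_⟩
    · rw [Finset.mem_finsuppAntidiag]
      refine ⟨?_, Finset.subset_univ _⟩
      have : ((∑ i, (y i).toNat : ℕ) : ℝ) = m := by
        push_cast
        rw [← hy]
        exact Finset.sum_congr rfl fun i _ => hcast i
      exact_mod_cast this
    · intro i _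
      simpa [hcast] using ha i
    · simp [lawrenceFiberMap, hy0]

lemma latticeCount_eq (hn : 0 < n) (m : ℕ) :
    latticeCount d n (lawrencePolytope d n b) m =
      ∑ w ∈ Finset.finsuppAntidiag (Finset.univ : Finset (Fin n)) m,
        ∑ F : Finset (Fin n), if memMatroid d n b F then
          (∏ i ∈ F, w i) * ∑ G ∈ F.powerset, boxCount d n b G else 0 := by
  have hfin : ∀ w : Fin n → ℕ, (zonotopePoints (toRHom d) b w Finset.univ).Finite := fun w =>
    Set.finite_of_encard_eq_coe (encard_zonotopePoints_toRHom b w)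
  have hcard : ∀ w : Fin n → ℕ, Nat.card (zonotopePoints (toRHom d) b w Finset.univ) =
      ∑ F : Finset (Fin n), if memMatroid d n b F then
        (∏ i ∈ F, w i) * ∑ G ∈ F.powerset, boxCount d n b G else 0 := fun w => by
    have h := encard_zonotopePoints_toRHom b w
    rw [← (hfin w).cast_ncard_eq] at h
    exact Nat.cast_injective h
  have (w : Fin n → ℕ) : Finite (zonotopePoints (toRHom d) b w Finset.univ) := hfin w
  have h := Nat.card_congr (Equiv.ofBijective _ (lawrenceFiberMap_bijective hn b m))
  rw [Nat.card_sigma] at h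
  simp only [hcard] at h
  rw [latticeCount, ← h]
  exact Finset.sum_coe_sort (Finset.finsuppAntidiag (Finset.univ : Finset (Fin n)) m)
    fun w => ∑ F : Finset (Fin n), if memMatroid d n b F then
      (∏ i ∈ F, w i) * ∑ G ∈ F.powerset, boxCount d n b G else 0

end LatticeCount

section GeneratingFunction

lemma one_sub_X_mul_mk_one :
    (1 - PowerSeries.X) * PowerSeries.mk (fun _ => (1 : ℤ)) = 1 := by
  rw [mul_comm]
  exact PowerSeries.mk_one_mul_one_sub_eq_one ℤ

lemma one_sub_X_sq_mul_mk_cast :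
    (1 - PowerSeries.X) ^ 2 * PowerSeries.mk (fun k => (k : ℤ)) = PowerSeries.X := by
  have h : (1 - PowerSeries.X) * PowerSeries.mk (fun k => (k : ℤ)) =
      PowerSeries.X * PowerSeries.mk (fun _ => (1 : ℤ)) := by
    ext k
    cases k with
    | zero => simp
    | succ k => simp [sub_mul, PowerSeries.coeff_succ_X_mul]
  rw [pow_two, mul_assoc, h, mul_left_comm, one_sub_X_mul_mk_one, mul_one]

lemma coeff_one_sub_X_pow_self (k : ℕ) :
    PowerSeries.coeff k ((1 - PowerSeries.X : PowerSeries ℤ) ^ k) = (-1) ^ k := by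
  have h : (1 - PowerSeries.X : PowerSeries ℤ) ^ k =
      (((-1) ^ k * (X - C 1) ^ k : ℤ[X]) : PowerSeries ℤ) := by
    rw [← mul_pow]
    simp
  have h1 := (Polynomial.monic_X_sub_C (1 : ℤ)).pow k
  have h2 : ((X - C (1 : ℤ)) ^ k).natDegree = k := by
    rw [Polynomial.natDegree_pow, Polynomial.natDegree_X_sub_C, mul_one]
  have h3 : (-1 : ℤ[X]) ^ k = C ((-1) ^ k) := by simp
  rw [h, Polynomial.coeff_coe, h3, Polynomial.coeff_C_mul]
  have h4 := h1.coeff_natDegree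
  rw [h2] at h4
  rw [h4, mul_one]

lemma one_sub_X_pow_mul_mk {ι : Type*} [Fintype ι] [DecidableEq ι] (F : Finset ι) :
    (1 - PowerSeries.X) ^ (Fintype.card ι + F.card) * PowerSeries.mk (fun m =>
      ∑ w ∈ Finset.finsuppAntidiag (Finset.univ : Finset ι) m, ∏ i ∈ F, (w i : ℤ)) =
      PowerSeries.X ^ F.card := by
  have h : PowerSeries.mk (fun m =>
      ∑ w ∈ Finset.finsuppAntidiag (Finset.univ : Finset ι) m, ∏ i ∈ F, (w i : ℤ)) =
      ∏ i, if i ∈ F then PowerSeries.mk (fun k => (k : ℤ)) else PowerSeries.mk fun _ => 1 := by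
    ext m
    rw [PowerSeries.coeff_mk, PowerSeries.coeff_prod]
    refine Finset.sum_congr rfl fun w _ => ?_
    rw [← Finset.prod_subset (Finset.subset_univ F) fun i _ hi => by simp [hi]]
    exact Finset.prod_congr rfl fun i hi => by simp [hi]
  have h2 : (1 - PowerSeries.X : PowerSeries ℤ) ^ (Fintype.card ι + F.card) =
      ∏ i, if i ∈ F then (1 - PowerSeries.X) ^ 2 else 1 - PowerSeries.X := by
    rw [pow_add, ← Finset.card_univ, ← Finset.prod_const, ← Finset.prod_const,
      ← Finset.univ_inter F, ← Finset.prod_ite_mem, ← Finset.prod_mul_distrib, Finset.univ_inter]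
    refine Finset.prod_congr rfl fun i _ => ?_
    by_cases hi : i ∈ F <;> simp [hi, pow_two]
  rw [h, h2, ← Finset.prod_mul_distrib]
  rw [Finset.prod_congr rfl (g := fun i => if i ∈ F then PowerSeries.X else 1) fun i _ => by
    by_cases hi : i ∈ F <;>
      simp only [hi, if_true, if_false, one_sub_X_sq_mul_mk_cast, one_sub_X_mul_mk_one]]
  simp

end GeneratingFunction

section DeltaPolynomial

variable {d n : ℕ} {b : Fin n → Fin d → ℤ}

lemma memMatroid.card_le {F : Finset (Fin n)} (hF : memMatroid d n b F) : F.card ≤ d := by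
  simpa using LinearIndependent.fintype_card_le_finrank hF

lemma memMatroid.subset {F G : Finset (Fin n)} (hF : memMatroid d n b F) (h : G ⊆ F) :
    memMatroid d n b G :=
  LinearIndepOn.mono ((memMatroid_iff F).1 hF) (Finset.coe_subset.2 h)

theorem ehrhartSeries_eq (hn : 0 < n) (b : Fin n → Fin d → ℤ) :
    (1 - PowerSeries.X) ^ (n + d) *
      PowerSeries.mk (fun m => (latticeCount d n (lawrencePolytope d n b) m : ℤ)) =
    ∑ F : Finset (Fin n), if memMatroid d n b F then
      PowerSeries.C ((∑ G ∈ F.powerset, boxCount d n b G : ℕ) : ℤ) *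
        (PowerSeries.X ^ F.card * (1 - PowerSeries.X) ^ (d - F.card)) else 0 := by
  have h : PowerSeries.mk (fun m => (latticeCount d n (lawrencePolytope d n b) m : ℤ)) =
      ∑ F : Finset (Fin n), if memMatroid d n b F then
        PowerSeries.C ((∑ G ∈ F.powerset, boxCount d n b G : ℕ) : ℤ) *
        PowerSeries.mk (fun m => ∑ w ∈ Finset.finsuppAntidiag (Finset.univ : Finset (Fin n)) m,
          ∏ i ∈ F, (w i : ℤ)) else 0 := by
    ext m
    rw [PowerSeries.coeff_mk, latticeCount_eq hn, Finset.sum_comm, map_sum, Nat.cast_sum]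
    refine Finset.sum_congr rfl fun F _ => ?_
    by_cases hF : memMatroid d n b F
    · simp only [if_pos hF, PowerSeries.coeff_C_mul, PowerSeries.coeff_mk, Finset.mul_sum]
      push_cast
      exact Finset.sum_congr rfl fun w _ => by rw [← Finset.mul_sum, mul_comm]
    · simp [if_neg hF]
  rw [h, Finset.mul_sum]
  refine Finset.sum_congr rfl fun F _ => ?_
  by_cases hF : memMatroid d n b F
  · have hnd : n + d = (d - F.card) + (Fintype.card (Fin n) + F.card) := by
      have := hF.card_le
      rw [Fintype.card_fin]
      omega
    rw [if_pos hF, if_pos hF, ← one_sub_X_pow_mul_mk F, hnd, pow_add]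
    ring
  · rw [if_neg hF, if_neg hF, mul_zero]

lemma coeff_X_pow_mul_one_sub_X_pow {k d : ℕ} (h : k ≤ d) :
    PowerSeries.coeff d (PowerSeries.X ^ k * (1 - PowerSeries.X : PowerSeries ℤ) ^ (d - k)) =
      (-1) ^ (d + k) := by
  rw [PowerSeries.coeff_X_pow_mul', if_pos h, coeff_one_sub_X_pow_self]
  obtain ⟨l, rfl⟩ := Nat.exists_eq_add_of_le h
  rw [Nat.add_sub_cancel_left, add_right_comm, pow_add, (Even.add_self k).neg_one_pow, one_mul]

end DeltaPolynomial

/-- `δ_d = Σ_{F ∈ M_B} #(BOX(F) ∩ ℤ^d) R^bd_F`. -/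
theorem statement4 (d n : ℕ) (hd : 0 < d) (hn : 0 < n)
    (b : Fin n → Fin d → ℤ) (hb : ∀ i, b i ≠ 0)
    (hgen : Submodule.span ℤ (Set.range b) = ⊤)
    (r : Fin n → ℝ) (hr : Simple d n b r)
    (δ : Polynomial ℤ) (hδ : IsDeltaPoly d n (lawrencePolytope d n b) δ) :
    δ.coeff d = ∑ F : Finset (Fin n),
      if memMatroid d n b F then
        (boxCount d n b F : ℤ) * boundedRegionCount d n b r F
      else 0 := by
  rw [← Polynomial.coeff_coe, ← hδ.2, ehrhartSeries_eq hn, map_sum]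
  calc ∑ F : Finset (Fin n), PowerSeries.coeff d (if memMatroid d n b F then
          PowerSeries.C ((∑ G ∈ F.powerset, boxCount d n b G : ℕ) : ℤ) *
            (PowerSeries.X ^ F.card * (1 - PowerSeries.X) ^ (d - F.card)) else 0)
      = ∑ F : Finset (Fin n), ∑ G : Finset (Fin n), if G ⊆ F ∧ memMatroid d n b F then
          (boxCount d n b G : ℤ) * (-1) ^ (d + F.card) else 0 := by
        refine Finset.sum_congr rfl fun F _ => ?_
        by_cases hF : memMatroid d n b F
        · rw [if_pos hF, PowerSeries.coeff_C_mul, coeff_X_pow_mul_one_sub_X_pow hF.card_le]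
          push_cast
          rw [Finset.sum_mul, ← Finset.sum_filter]
          exact Finset.sum_congr (by ext G; simp [hF]) fun _ _ => rfl
        · simp [hF]
    _ = ∑ G : Finset (Fin n), ∑ F : Finset (Fin n), if G ⊆ F ∧ memMatroid d n b F then
          (boxCount d n b G : ℤ) * (-1) ^ (d + F.card) else 0 := Finset.sum_comm
    _ = _ := by
        refine Finset.sum_congr rfl fun G _ => ?_
        by_cases hG : memMatroid d n b G
        · rw [if_pos hG, boundedRegionCount_eq hgen hr G hG, Finset.mul_sum]
          exact Finset.sum_congr rfl fun F _ => by rw [mul_ite, mul_zero]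
        · rw [if_neg hG]
          exact Finset.sum_eq_zero fun F _ => if_neg fun h => hG (h.2.subset h.1)

end LawrencePaper
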